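/- arXiv:2304.05267 — 4 statements merged into one kernel-verified Lean document; each statement's English description precedes it below -/
import Mathlib

section
/- Let Γ be a finite simple graph with connected components Γ₁, …, Γ_n (viewed as induced subgraphs). Then A(Γ) is isomorphic to the free product A(Γ₁) ∗ ⋯ ∗ A(Γ_n). Moreover, A(Γ) splits non-trivially as a free product (i.e. A(Γ) ≅ G ∗ H with both G and H non-trivial) if and only if Γ is disconnected. -/
universe u

/-- The defining relators of the right-angled Artin group of a simple graph. -/
def raagRels {V : Type u} (Γ : SimpleGraph V) : Set (FreeGroup V) :=
  {r | ∃ u v : V, Γ.Adj u v ∧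
    r = FreeGroup.of u * FreeGroup.of v * (FreeGroup.of u)⁻¹ * (FreeGroup.of v)⁻¹}

/-- The right-angled Artin group of a simple graph. -/
abbrev RAAG {V : Type u} (Γ : SimpleGraph V) : Type u := PresentedGroup (raagRels Γ)

/-- The generator of `RAAG Γ` corresponding to a vertex. -/
def raagGen {V : Type u} (Γ : SimpleGraph V) (u : V) : RAAG Γ :=
  PresentedGroup.of (rels := raagRels Γ) u

open Filter Monoid

section Lift

variable {V : Type*} {Γ : SimpleGraph V} {K : Type*} [Group K]

theorem commute_raagGen {u v : V} (h : Γ.Adj u v) : Commute (raagGen Γ u) (raagGen Γ v) := by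
  have h1 : PresentedGroup.mk (raagRels Γ) _ = 1 :=
    PresentedGroup.one_of_mem (rels := raagRels Γ) ⟨u, v, h, rfl⟩
  simp only [map_mul, map_inv] at h1
  exact mul_inv_eq_iff_eq_mul.mp (mul_inv_eq_one.mp h1)

/-- The universal property of a right-angled Artin group. -/
def raagLift (f : V → K) (hf : ∀ u v, Γ.Adj u v → Commute (f u) (f v)) : RAAG Γ →* K :=
  PresentedGroup.toGroup (f := f) <| by
    rintro _ ⟨u, v, h, rfl⟩
    simp [(hf u v h).eq]

@[simp]
theorem raagLift_gen (f : V → K) (hf : ∀ u v, Γ.Adj u v → Commute (f u) (f v)) (u : V) :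
    raagLift f hf (raagGen Γ u) = f u :=
  PresentedGroup.toGroup.of _

theorem raag_hom_ext {M : Type*} [Monoid M] {φ ψ : RAAG Γ →* M}
    (h : ∀ u, φ (raagGen Γ u) = ψ (raagGen Γ u)) : φ = ψ := by
  refine MonoidHom.eq_of_eqOn_dense (PresentedGroup.closure_range_of (raagRels Γ)) ?_
  rintro _ ⟨u, rfl⟩
  exact h u

/-- The exponent sum of a generator. -/
def raagExponent [DecidableEq V] (Γ : SimpleGraph V) (u : V) : RAAG Γ →* Multiplicative ℤ :=
  raagLift (fun v => Multiplicative.ofAdd (if v = u then 1 else 0)) fun _ _ _ => Commute.all _ _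

theorem raagExponent_gen [DecidableEq V] (u v : V) :
    (raagExponent Γ u (raagGen Γ v)).toAdd = if v = u then 1 else 0 := by
  simp [raagExponent]

theorem raagGen_ne_one (u : V) : raagGen Γ u ≠ 1 := by
  classical
  intro h
  simpa [h] using raagExponent_gen (Γ := Γ) u u

theorem raag_mul_comm_of_subsingleton [Subsingleton V] (a b : RAAG Γ) : a * b = b * a := by
  have key : ∀ c : RAAG Γ, (∀ u, Commute (raagGen Γ u) c) → ∀ d, Commute d c := fun c hc d =>
    (Subgroup.mem_centralizer_singleton_iff.mp <| PresentedGroup.generated_by (raagRels Γ)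
      (Subgroup.centralizer {c}) (fun u => Subgroup.mem_centralizer_singleton_iff.mpr (hc u)) d)
  refine key b (fun u => (key _ (fun v => ?_) b).symm) a
  rw [Subsingleton.elim u v]

end Lift

section Decomposition

variable {V : Type*} (Γ : SimpleGraph V)

/-- The homomorphism of right-angled Artin groups given by an induced subgraph. -/
def raagInduce (s : Set V) : RAAG (Γ.induce s) →* RAAG Γ :=
  raagLift (fun u => raagGen Γ u) fun _ _ h => commute_raagGen h

@[simp]
theorem raagInduce_gen (s : Set V) (u : s) :
    raagInduce Γ s (raagGen (Γ.induce s) u) = raagGen Γ u := by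
  simp [raagInduce]

/-- A right-angled Artin group is the free product of the right-angled Artin groups of the
connected components of the graph. -/
def raagEquivCoprodI :
    RAAG Γ ≃* CoprodI fun c : Γ.ConnectedComponent => RAAG (Γ.induce c.supp) :=
  MonoidHom.toMulEquiv
    (raagLift
      (fun v => CoprodI.of (i := Γ.connectedComponentMk v) (raagGen (Γ.induce _) ⟨v, rfl⟩))
      (by
        intro u v h
        have key : ∀ (c : Γ.ConnectedComponent) (hv : Γ.connectedComponentMk v = c),
            (CoprodI.of (i := Γ.connectedComponentMk v) (raagGen (Γ.induce _) ⟨v, rfl⟩) :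
              CoprodI fun c : Γ.ConnectedComponent => RAAG (Γ.induce c.supp)) =
            CoprodI.of (i := c) (raagGen (Γ.induce _) ⟨v, hv⟩) := by
          rintro _ rfl
          rfl
        have hv : v ∈ (Γ.connectedComponentMk u).supp :=
          SimpleGraph.ConnectedComponent.eq.mpr h.symm.reachable
        rw [key _ hv]
        exact Commute.map (commute_raagGen (Γ := Γ.induce (Γ.connectedComponentMk u).supp)
          (u := ⟨u, rfl⟩) (v := ⟨v, hv⟩) (SimpleGraph.induce_adj.mpr h))
          (CoprodI.of (M := fun c : Γ.ConnectedComponent => RAAG (Γ.induce c.supp)))))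
    (CoprodI.lift fun c => raagInduce Γ c.supp)
    (raag_hom_ext fun u => by simp)
    (CoprodI.ext_hom _ _ fun c => raag_hom_ext fun ⟨u, hu⟩ => by
      obtain rfl : Γ.connectedComponentMk u = c := hu
      simp)

open Classical in
/-- A set of vertices not joined by an edge to its complement splits a right-angled Artin group. -/
noncomputable def raagEquivCoprod (s : Set V) (hs : ∀ u v, Γ.Adj u v → (u ∈ s ↔ v ∈ s)) :
    RAAG Γ ≃* Coprod (RAAG (Γ.induce s)) (RAAG (Γ.induce sᶜ)) :=
  MonoidHom.toMulEquiv
    (raagLift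
      (fun v => if h : v ∈ s then Coprod.inl (raagGen (Γ.induce s) ⟨v, h⟩)
        else Coprod.inr (raagGen (Γ.induce sᶜ) ⟨v, h⟩))
      (by
        intro u v h
        by_cases hu : u ∈ s
        · have hv := (hs u v h).mp hu
          simp only [hu, hv, dite_true]
          exact Commute.map (commute_raagGen (SimpleGraph.induce_adj.mpr h)) Coprod.inl
        · have hv : v ∉ s := fun hv => hu ((hs u v h).mpr hv)
          simp only [hu, hv, dite_false]
          exact Commute.map (commute_raagGen (SimpleGraph.induce_adj.mpr h)) Coprod.inr))
    (Coprod.lift (raagInduce Γ s) (raagInduce Γ sᶜ))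
    (raag_hom_ext fun u => by
      by_cases hu : u ∈ s <;> simp [hu])
    (Coprod.hom_ext (raag_hom_ext fun ⟨u, hu⟩ => by simp [hu])
      (raag_hom_ext fun ⟨u, hu⟩ => by
        have hu' : u ∉ s := hu
        simp [hu']))

end Decomposition

section Heisenberg

variable {G H : Type*} [Group G] [Group H]

/-- Integral characters of the two factors of a free product have vanishing cup product. -/
theorem Commute.characters_mul_eq (α : G →* Multiplicative ℤ) (β : H →* Multiplicative ℤ)
    {x y : Coprod G H} (h : Commute x y) :
    (α (Coprod.fst x)).toAdd * (β (Coprod.snd y)).toAdd =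
      (α (Coprod.fst y)).toAdd * (β (Coprod.snd x)).toAdd := by
  let A : G →* Matrix (Fin 3) (Fin 3) ℤ :=
    { toFun g := !![1, (α g).toAdd, 0; 0, 1, 0; 0, 0, 1]
      map_one' := by simp [Matrix.one_fin_three]
      map_mul' a b := by simp [add_comm] }
  let B : H →* Matrix (Fin 3) (Fin 3) ℤ :=
    { toFun g := !![1, 0, 0; 0, 1, (β g).toAdd; 0, 0, 1]
      map_one' := by simp [Matrix.one_fin_three]
      map_mul' a b := by simp [add_comm] }
  have key : ∀ z : Coprod G H, ∃ c, Coprod.lift A B z =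
      !![1, (α (Coprod.fst z)).toAdd, c; 0, 1, (β (Coprod.snd z)).toAdd; 0, 0, 1] := by
    intro z
    induction z using Coprod.induction_on with
    | inl g => exact ⟨0, by simp [A]⟩
    | inr g => exact ⟨0, by simp [B]⟩
    | mul a b ha hb =>
      obtain ⟨c, hc⟩ := ha
      obtain ⟨d, hd⟩ := hb
      exact ⟨d + (α (Coprod.fst a)).toAdd * (β (Coprod.snd b)).toAdd + c, by
        rw [map_mul, hc, hd]; simp [add_comm, add_left_comm]⟩
  obtain ⟨c, hc⟩ := key x
  obtain ⟨d, hd⟩ := key y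
  have h1 := congrFun (congrFun (h.map (Coprod.lift A B)).eq 0) 2
  rw [hc, hd] at h1
  simp [Matrix.mul_apply, Fin.sum_univ_three] at h1
  linarith

end Heisenberg

namespace RegularWreathProduct

variable {D Q : Type*} [Group D] [Group Q]

theorem pow_right (w : D ≀ᵣ Q) (n : ℕ) : (w ^ n).right = w.right ^ n :=
  map_pow rightHom w n

theorem pow_left_eq_one {w : D ≀ᵣ Q} {x : Q} (h : ∀ k : ℕ, w.left ((w.right ^ k)⁻¹ * x) = 1)
    (n : ℕ) : (w ^ n).left x = 1 := by
  induction n with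
  | zero => simp
  | succ n ih => simp [pow_succ, ih, pow_right, h]

theorem eventually_pow_left_eq_one {w : D ≀ᵣ Q} (hw : w.left.mulSupport.Finite) {s : Q}
    (hs : Function.Injective fun p : ℕ × ℕ => s ^ p.1 * w.right ^ p.2) (x : Q) :
    ∀ᶠ N : ℕ in atTop, ∀ M : ℕ, (w ^ M).left ((s ^ N)⁻¹ * x) = 1 := by
  have hinj : Function.Injective fun p : ℕ × ℕ => (w.right ^ p.2)⁻¹ * ((s ^ p.1)⁻¹ * x) := by
    intro p q hpq
    refine hs (inv_injective (mul_right_cancel (b := x) ?_))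
    simpa [mul_assoc] using hpq
  have hfin := (hw.preimage hinj.injOn).image Prod.fst
  rw [← Nat.cofinite_eq_atTop]
  filter_upwards [hfin.compl_mem_cofinite] with N hN
  refine pow_left_eq_one fun k => ?_
  by_contra hk
  exact hN ⟨(N, k), hk, rfl⟩

/-- The powers of two commuting finitely supported elements of a wreath product whose images
generate a free abelian group of rank two have the same pointwise limit. -/
theorem exists_eventually_pow_left_eq {w w' : D ≀ᵣ Q} (h : Commute w w')
    (hw : w.left.mulSupport.Finite) (hw' : w'.left.mulSupport.Finite)
    (hind : Function.Injective fun p : ℕ × ℕ => w.right ^ p.1 * w'.right ^ p.2) (x : Q) :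
    ∃ c, (∀ᶠ N : ℕ in atTop, (w ^ N).left x = c) ∧ ∀ᶠ N : ℕ in atTop, (w' ^ N).left x = c := by
  have hright : Commute w.right w'.right := h.map rightHom
  have hind' : Function.Injective fun p : ℕ × ℕ => w'.right ^ p.1 * w.right ^ p.2 := by
    intro p q hpq
    simp only [← (hright.pow_pow _ _).eq] at hpq
    exact Prod.swap_injective (hind (a₁ := p.swap) (a₂ := q.swap) hpq)
  have h1 := eventually_pow_left_eq_one hw' hind x
  have h2 := eventually_pow_left_eq_one hw hind' x
  have heq : ∀ N M : ℕ, (∀ M, (w' ^ M).left ((w.right ^ N)⁻¹ * x) = 1) →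
      (∀ N, (w ^ N).left ((w'.right ^ M)⁻¹ * x) = 1) → (w ^ N).left x = (w' ^ M).left x := by
    intro N M hN hM
    have := congrFun (congrArg RegularWreathProduct.left (h.pow_pow N M).eq) x
    simpa [pow_right, hN, hM] using this
  obtain ⟨N, hN⟩ := h1.exists
  obtain ⟨M, hM⟩ := h2.exists
  refine ⟨(w ^ N).left x, ?_, ?_⟩
  · filter_upwards [h1] with N' hN'
    rw [heq N' M hN' hM, heq N M hN hM]
  · filter_upwards [h2] with M' hM'
    rw [heq N M' hN hM']

/-- If the powers of `w` converge pointwise to `F`, then `F` conjugates `w` into the top group. -/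
theorem mul_eq_of_eventually_pow_left_eq {w : D ≀ᵣ Q} {F : Q → D}
    (hF : ∀ x, ∀ᶠ N : ℕ in atTop, (w ^ N).left x = F x) :
    w * ⟨F, 1⟩ = ⟨F, 1⟩ * inl w.right := by
  ext x
  · obtain ⟨N, h1, h2⟩ :=
      (((tendsto_add_atTop_nat 1).eventually (hF x)).and (hF (w.right⁻¹ * x))).exists
    rw [pow_succ'] at h1
    simpa [h2] using h1
  · simp

end RegularWreathProduct

section Wreath

variable {G H : Type*} [Group G] [Group H]

open Classical in
/-- The embedding of the base group at the identity coordinate of the regular wreath product. -/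
noncomputable def wreathSingle : G →* G ≀ᵣ H where
  toFun g := ⟨Pi.mulSingle 1 g, 1⟩
  map_one' := by ext <;> simp
  map_mul' a b := by ext <;> simp [Pi.mulSingle_mul]

/-- The natural homomorphism from a free product to the regular wreath product. -/
noncomputable def coprodToWreath : Coprod G H →* G ≀ᵣ H :=
  Coprod.lift wreathSingle RegularWreathProduct.inl

theorem coprodToWreath_right (x : Coprod G H) : (coprodToWreath x).right = Coprod.snd x := by
  have : RegularWreathProduct.rightHom.comp (coprodToWreath (G := G) (H := H)) = Coprod.snd :=
    Coprod.hom_ext rfl rfl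
  exact DFunLike.congr_fun this x

theorem coprodToWreath_left_finite (x : Coprod G H) :
    (coprodToWreath x).left.mulSupport.Finite := by
  classical
  induction x using Coprod.induction_on with
  | inl g =>
    exact (Set.finite_singleton (1 : H)).subset Pi.mulSupport_mulSingle_subset
  | inr h => simp [coprodToWreath]
  | mul a b ha hb =>
    rw [map_mul, RegularWreathProduct.mul_left]
    refine (ha.union ?_).subset (Function.mulSupport_mul _ _)
    exact hb.preimage (mul_right_injective _).injOn

theorem coprod_not_commute {g : G} {h : H} (hg : g ≠ 1) (hh : h ≠ 1) :
    ¬ Commute (Coprod.inl g : Coprod G H) (Coprod.inr h) := by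
  classical
  intro hc
  have := congrFun (congrArg RegularWreathProduct.left (hc.map coprodToWreath).eq) 1
  simp [coprodToWreath, wreathSingle, hh, hg] at this

end Wreath

section Connected

variable {V : Type*} {Γ : SimpleGraph V} {G H : Type*} [Group G] [Group H]

theorem SimpleGraph.Preconnected.forall_of_forall_adj (hΓ : Γ.Preconnected) {p : V → Prop}
    (hp : ∀ u v, Γ.Adj u v → p u → p v) {u : V} (hu : p u) (v : V) : p v := by
  obtain ⟨w⟩ := hΓ u v
  induction w with
  | nil => exact hu
  | cons h _ ih => exact ih (hp _ _ h hu)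

theorem raagExponent_inl_add_raagExponent_inr [DecidableEq V] (e : RAAG Γ ≃* Coprod G H)
    (u v : V) :
    (raagExponent Γ u (e.symm (Coprod.inl (Coprod.fst (e (raagGen Γ v)))))).toAdd +
      (raagExponent Γ u (e.symm (Coprod.inr (Coprod.snd (e (raagGen Γ v)))))).toAdd =
      if v = u then 1 else 0 := by
  have h : ∀ x : Coprod G H, raagExponent Γ u (e.symm x) =
      raagExponent Γ u (e.symm (Coprod.inl (Coprod.fst x))) *
      raagExponent Γ u (e.symm (Coprod.inr (Coprod.snd x))) := by
    intro x
    induction x using Coprod.induction_on with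
    | inl g => simp
    | inr h => simp
    | mul a b ha hb =>
      simp only [map_mul, ha, hb]
      exact mul_mul_mul_comm _ _ _ _
  rw [← toAdd_mul, ← h, e.symm_apply_apply, raagExponent_gen]

/-- The endpoints of an edge are not detected by characters of different free factors. -/
theorem character_eq_one_or_of_adj (e : RAAG Γ ≃* Coprod G H) {u v : V} (h : Γ.Adj u v)
    (α : G →* Multiplicative ℤ) (β : H →* Multiplicative ℤ) :
    α (Coprod.fst (e (raagGen Γ u))) = 1 ∨ β (Coprod.snd (e (raagGen Γ v))) = 1 := by
  classical
  have hc : Commute (e (raagGen Γ u)) (e (raagGen Γ v)) := (commute_raagGen h).map e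
  let χ : Coprod G H →* Multiplicative ℤ := (raagExponent Γ v).comp e.symm.toMonoidHom
  have r1 := hc.characters_mul_eq α β
  have r2 := hc.characters_mul_eq α (χ.comp Coprod.inr)
  have r3 := hc.characters_mul_eq (χ.comp Coprod.inl) β
  have s1 := raagExponent_inl_add_raagExponent_inr e v u
  have s2 := raagExponent_inl_add_raagExponent_inr e v v
  simp only [χ, MonoidHom.comp_apply, MulEquiv.toMonoidHom_eq_coe, MonoidHom.coe_coe] at r2 r3
  simp only [h.ne, if_true, if_false] at s1 s2
  rw [← toAdd_eq_zero, ← toAdd_eq_zero]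
  generalize (α (Coprod.fst (e (raagGen Γ u)))).toAdd = a at *
  generalize (α (Coprod.fst (e (raagGen Γ v)))).toAdd = a' at *
  generalize (β (Coprod.snd (e (raagGen Γ u)))).toAdd = b at *
  generalize (β (Coprod.snd (e (raagGen Γ v)))).toAdd = b' at *
  generalize (raagExponent Γ v (e.symm (Coprod.inl (Coprod.fst (e (raagGen Γ u)))))).toAdd = p at *
  by_contra! hne
  have hb : a * b ≠ 0 := by
    refine mul_ne_zero hne.1 ?_
    rintro rfl
    rw [mul_zero] at r1
    exact mul_ne_zero hne.1 hne.2 r1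
  refine hb ?_
  linear_combination (-(a * b)) * s2 + b * r2 - a * r3 + (a' * b) * s1 + p * r1

/-- Some free factor is not detected by characters. -/
theorem forall_character_eq_one_or [Nontrivial V] (hΓ : Γ.Preconnected)
    (e : RAAG Γ ≃* Coprod G H) :
    (∀ (α : G →* Multiplicative ℤ) (u : V), α (Coprod.fst (e (raagGen Γ u))) = 1) ∨
      ∀ (β : H →* Multiplicative ℤ) (u : V), β (Coprod.snd (e (raagGen Γ u))) = 1 := by
  classical
  by_contra! hne
  obtain ⟨⟨α, u, hα⟩, β, v, hβ⟩ := hne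
  have hprop : ∀ u v, Γ.Adj u v →
      (∃ α : G →* Multiplicative ℤ, α (Coprod.fst (e (raagGen Γ u))) ≠ 1) →
      ∃ α : G →* Multiplicative ℤ, α (Coprod.fst (e (raagGen Γ v))) ≠ 1 := by
    rintro u v h ⟨α, hα⟩
    let χ : Coprod G H →* Multiplicative ℤ := (raagExponent Γ v).comp e.symm.toMonoidHom
    refine ⟨χ.comp Coprod.inl, fun h1 => ?_⟩
    have h2 := (character_eq_one_or_of_adj e h α (χ.comp Coprod.inr)).resolve_left hα
    have h3 := raagExponent_inl_add_raagExponent_inr e v v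
    simp only [χ, MonoidHom.comp_apply, MulEquiv.toMonoidHom_eq_coe, MonoidHom.coe_coe] at h1 h2
    simp [h1, h2] at h3
  obtain ⟨w, hw⟩ := hΓ.exists_adj_of_nontrivial v
  obtain ⟨α', hα'⟩ := hΓ.forall_of_forall_adj hprop ⟨α, hα⟩ w
  exact (character_eq_one_or_of_adj e hw.symm α' β).elim hα' hβ

/-- If no character of the left factor detects a generator, then the left factor is trivial. -/
theorem eq_one_of_forall_character_eq_one [Nontrivial V] (hΓ : Γ.Preconnected)
    (e : RAAG Γ ≃* Coprod G H)
    (hα : ∀ (α : G →* Multiplicative ℤ) (u : V), α (Coprod.fst (e (raagGen Γ u))) = 1) (g : G) :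
    g = 1 := by
  classical
  let ψ : RAAG Γ →* G ≀ᵣ H := coprodToWreath.comp e.toMonoidHom
  have hψ : ∀ a, ψ a = coprodToWreath (e a) := fun _ => rfl
  have hβ : ∀ u v, ((raagExponent Γ u) (e.symm (Coprod.inr (Coprod.snd (e (raagGen Γ v)))))).toAdd
      = if v = u then 1 else 0 := by
    intro u v
    have h1 := raagExponent_inl_add_raagExponent_inr e u v
    have h2 := hα (((raagExponent Γ u).comp e.symm.toMonoidHom).comp Coprod.inl) v
    simp only [MonoidHom.comp_apply, MulEquiv.toMonoidHom_eq_coe, MonoidHom.coe_coe] at h2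
    simpa [h2] using h1
  have hlim : ∀ u v, Γ.Adj u v → ∀ x, ∃ c,
      (∀ᶠ N : ℕ in atTop, (ψ (raagGen Γ u) ^ N).left x = c) ∧
      ∀ᶠ N : ℕ in atTop, (ψ (raagGen Γ v) ^ N).left x = c := by
    intro u v h x
    refine RegularWreathProduct.exists_eventually_pow_left_eq ((commute_raagGen h).map ψ)
      (coprodToWreath_left_finite _) (coprodToWreath_left_finite _) ?_ x
    intro p q hpq
    simp only [hψ, coprodToWreath_right] at hpq
    have hdet := fun w => congrArg
      (fun y => ((raagExponent Γ w) (e.symm (Coprod.inr y))).toAdd) hpq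
    have hu := hdet u
    have hv := hdet v
    simp only [map_mul, map_pow, toAdd_mul, toAdd_pow, hβ] at hu hv
    simp [h.ne, h.ne'] at hu hv
    exact Prod.ext hu hv
  obtain ⟨u₀⟩ : Nonempty V := inferInstance
  obtain ⟨v₀, h₀⟩ := hΓ.exists_adj_of_nontrivial u₀
  choose F hF using fun x => (hlim u₀ v₀ h₀ x).imp fun _ => And.left
  have hF' : ∀ u x, ∀ᶠ N : ℕ in atTop, (ψ (raagGen Γ u) ^ N).left x = F x := by
    intro u
    refine hΓ.forall_of_forall_adj
      (p := fun u => ∀ x, ∀ᶠ N : ℕ in atTop, (ψ (raagGen Γ u) ^ N).left x = F x) ?_ hF u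
    intro u v h hu x
    obtain ⟨c, hc, hc'⟩ := hlim u v h x
    obtain ⟨N, h1, h2⟩ := (hc.and (hu x)).exists
    simpa [← h1, h2] using hc'
  have hconj : ψ = (MulAut.conj (⟨F, 1⟩ : G ≀ᵣ H)).toMonoidHom.comp
      (RegularWreathProduct.inl.comp (RegularWreathProduct.rightHom.comp ψ)) := by
    refine raag_hom_ext fun u => ?_
    have := RegularWreathProduct.mul_eq_of_eventually_pow_left_eq (hF' u)
    simpa using eq_mul_inv_of_mul_eq this
  have h1 := DFunLike.congr_fun hconj (e.symm (Coprod.inl g))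
  have h2 : (ψ (e.symm (Coprod.inl g))).right = 1 := by simp [hψ, coprodToWreath_right]
  have h3 : ψ (e.symm (Coprod.inl g)) = 1 := by simpa [h2] using h1
  have h4 := congrFun (congrArg RegularWreathProduct.left h3) 1
  simpa [hψ, coprodToWreath, wreathSingle] using h4

/-- The right-angled Artin group of a connected graph is freely indecomposable. -/
theorem SimpleGraph.Preconnected.raag_freely_indecomposable (hΓ : Γ.Preconnected)
    (e : RAAG Γ ≃* Coprod G H) : (∀ g : G, g = 1) ∨ ∀ h : H, h = 1 := by
  rcases subsingleton_or_nontrivial V with hV | hV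
  · by_contra! hne
    obtain ⟨⟨g, hg⟩, h, hh⟩ := hne
    refine coprod_not_commute hg hh (e.symm.injective ?_)
    rw [map_mul, map_mul, raag_mul_comm_of_subsingleton]
  · refine (forall_character_eq_one_or hΓ e).imp
      (fun hα => eq_one_of_forall_character_eq_one hΓ e hα) fun hβ =>
        eq_one_of_forall_character_eq_one hΓ (e.trans (MulEquiv.coprodComm G H)) fun β u => ?_
    rw [← hβ β u]
    exact congrArg β (Coprod.fst_swap _)

end Connected

/-- For a finite graph `Γ`, `A(Γ)` is the free product of the RAAGs of the induced
subgraphs on its connected components; and `A(Γ)` splits non-trivially as a free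
product iff `Γ` is disconnected. -/
theorem raag_coprodI_components {V : Type u} [Fintype V] (Γ : SimpleGraph V) :
    Nonempty (RAAG Γ ≃*
        Monoid.CoprodI fun c : Γ.ConnectedComponent => RAAG (Γ.induce c.supp)) ∧
    ((∃ (G H : Type u) (_ : Group G) (_ : Group H),
        (∃ g : G, g ≠ 1) ∧ (∃ h : H, h ≠ 1) ∧ Nonempty (RAAG Γ ≃* Monoid.Coprod G H)) ↔
      ¬ Γ.Preconnected) := by
  refine ⟨⟨raagEquivCoprodI Γ⟩, ?_, fun hΓ => ?_⟩
  · rintro ⟨G, H, _, _, ⟨g, hg⟩, ⟨h, hh⟩, ⟨e⟩⟩ hΓ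
    exact (hΓ.raag_freely_indecomposable e).elim (fun hG => hg (hG g)) fun hH => hh (hH h)
  · obtain ⟨u, v, huv⟩ : ∃ u v, ¬ Γ.Reachable u v := by
      simpa [SimpleGraph.Preconnected] using hΓ
    let s : Set V := {w | Γ.Reachable u w}
    refine ⟨RAAG (Γ.induce s), RAAG (Γ.induce sᶜ), inferInstance, inferInstance,
      ⟨_, raagGen_ne_one ⟨u, SimpleGraph.Reachable.refl u⟩⟩, ⟨_, raagGen_ne_one ⟨v, huv⟩⟩,
      ⟨raagEquivCoprod Γ s fun a b hab => ?_⟩⟩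
    exact ⟨fun h => h.trans hab.reachable, fun h => h.trans hab.symm.reachable⟩
end

section
/- Let Γ be a finite simple graph and let Γ^opp be its opposite graph. Let Γ₁, …, Γ_n be the induced subgraphs of Γ whose vertex sets are the connected components of Γ^opp. Then A(Γ) is isomorphic to the direct product A(Γ₁) × ⋯ × A(Γ_n). Moreover, A(Γ) splits non-trivially as a direct product (i.e. A(Γ) ≅ G × H with both G and H non-trivial) if and only if Γ^opp is disconnected. -/
universe u

namespace RAAG

variable {V : Type u} {Γ : SimpleGraph V}

theorem commute_gen {a b : V} (h : Γ.Adj a b) : Commute (raagGen Γ a) (raagGen Γ b) := by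
  have h1 : PresentedGroup.mk (raagRels Γ) (FreeGroup.of a * FreeGroup.of b *
      (FreeGroup.of a)⁻¹ * (FreeGroup.of b)⁻¹) = 1 :=
    PresentedGroup.one_of_mem ⟨a, b, h, rfl⟩
  simp only [map_mul, map_inv] at h1
  exact commutatorElement_eq_one_iff_mul_comm.mp h1

/-- The homomorphism out of a right-angled Artin group determined by images of the generators. -/
def lift {G : Type*} [Group G] (f : V → G) (hf : ∀ a b, Γ.Adj a b → Commute (f a) (f b)) :
    RAAG Γ →* G :=
  PresentedGroup.toGroup (rels := raagRels Γ) (f := f) (by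
    rintro r ⟨a, b, h, rfl⟩
    simp only [map_mul, map_inv, FreeGroup.lift_apply_of]
    exact commutatorElement_eq_one_iff_mul_comm.mpr (hf a b h))

@[simp]
theorem lift_gen {G : Type*} [Group G] (f : V → G)
    (hf : ∀ a b, Γ.Adj a b → Commute (f a) (f b)) (a : V) : lift f hf (raagGen Γ a) = f a :=
  PresentedGroup.toGroup.of _

theorem hom_ext {G : Type*} [Group G] {f g : RAAG Γ →* G}
    (h : ∀ a, f (raagGen Γ a) = g (raagGen Γ a)) : f = g :=
  PresentedGroup.ext h

/-- Homomorphisms with pointwise commuting values on generators have commuting images. -/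
theorem commute_of_gen {W G : Type*} [Group G] {Δ : SimpleGraph W} (f : RAAG Γ →* G)
    (g : RAAG Δ →* G) (h : ∀ a b, Commute (f (raagGen Γ a)) (g (raagGen Δ b)))
    (x : RAAG Γ) (y : RAAG Δ) : Commute (f x) (g y) := by
  have key : ∀ a, ∀ y, Commute (f (raagGen Γ a)) (g y) := by
    intro a y
    have : y ∈ (Subgroup.centralizer {f (raagGen Γ a)}).comap g := by
      refine PresentedGroup.generated_by _ _ (fun b => ?_) y
      exact Subgroup.mem_centralizer_singleton_iff.mpr (h a b).symm.eq
    exact (Subgroup.mem_centralizer_singleton_iff.mp this : Commute _ _).symm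
  have : x ∈ (Subgroup.centralizer {g y}).comap f := by
    refine PresentedGroup.generated_by _ _ (fun a => ?_) x
    exact Subgroup.mem_centralizer_singleton_iff.mpr (key a y).eq
  exact Subgroup.mem_centralizer_singleton_iff.mp this

/-! ### The decomposition over the components of the complement -/

section Components

theorem adj_of_component_ne {a b : V}
    (h : Γᶜ.connectedComponentMk a ≠ Γᶜ.connectedComponentMk b) : Γ.Adj a b := by
  by_contra hab
  refine h (SimpleGraph.ConnectedComponent.sound (SimpleGraph.Adj.reachable ?_))
  exact (SimpleGraph.compl_adj _ _ _).mpr ⟨fun e => h (e ▸ rfl), hab⟩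

/-- The homomorphism induced by the inclusion of an induced subgraph. -/
def inclusion (Γ : SimpleGraph V) (s : Set V) : RAAG (Γ.induce s) →* RAAG Γ :=
  lift (fun a => raagGen Γ a) fun _ _ h => commute_gen h

@[simp]
theorem inclusion_gen (s : Set V) (a : s) :
    inclusion Γ s (raagGen (Γ.induce s) a) = raagGen Γ a :=
  lift_gen _ _ _

open Classical in
/-- The homomorphism to the product of the factors of the components of the complement. -/
noncomputable def toPiComponents (Γ : SimpleGraph V) :
    RAAG Γ →* ∀ c : Γᶜ.ConnectedComponent, RAAG (Γ.induce c.supp) :=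
  lift (fun a => Pi.mulSingle (Γᶜ.connectedComponentMk a) (raagGen (Γ.induce _) ⟨a, rfl⟩)) (by
    intro a b hab
    by_cases h : Γᶜ.connectedComponentMk a = Γᶜ.connectedComponentMk b
    · have key : ∀ (c d : Γᶜ.ConnectedComponent) (_ : c = d) (ha : a ∈ c.supp) (hb : b ∈ d.supp),
          Commute (Pi.mulSingle c (raagGen (Γ.induce c.supp) ⟨a, ha⟩) :
            ∀ c : Γᶜ.ConnectedComponent, RAAG (Γ.induce c.supp))
            (Pi.mulSingle d (raagGen (Γ.induce d.supp) ⟨b, hb⟩)) := by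
        rintro c _ rfl ha hb
        exact (commute_gen (Γ := Γ.induce c.supp) (a := ⟨a, ha⟩) (b := ⟨b, hb⟩) hab).map
          (MonoidHom.mulSingle (fun c : Γᶜ.ConnectedComponent => RAAG (Γ.induce c.supp)) c)
      exact key _ _ h rfl rfl
    · exact Pi.mulSingle_commute h _ _)

open Classical in
theorem toPiComponents_gen (c : Γᶜ.ConnectedComponent) (a : c.supp) :
    toPiComponents Γ (raagGen Γ a) = Pi.mulSingle c (raagGen (Γ.induce c.supp) a) := by
  obtain ⟨a, rfl⟩ := a
  exact lift_gen _ _ _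

theorem inclusion_pairwise_commute : Pairwise fun c d : Γᶜ.ConnectedComponent =>
    ∀ (x : RAAG (Γ.induce c.supp)) (y : RAAG (Γ.induce d.supp)),
      Commute (inclusion Γ c.supp x) (inclusion Γ d.supp y) := by
  intro c d h x y
  refine commute_of_gen _ _ ?_ x y
  rintro ⟨a, rfl⟩ ⟨b, rfl⟩
  simpa using commute_gen (adj_of_component_ne h)

theorem nonempty_equiv_pi [Finite V] (Γ : SimpleGraph V) :
    Nonempty (RAAG Γ ≃* ∀ c : Γᶜ.ConnectedComponent, RAAG (Γ.induce c.supp)) := by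
  classical
  have : Fintype Γᶜ.ConnectedComponent := Fintype.ofFinite _
  let ψ := MonoidHom.noncommPiCoprod (fun c : Γᶜ.ConnectedComponent => inclusion Γ c.supp)
    inclusion_pairwise_commute
  refine ⟨MonoidHom.toMulEquiv (toPiComponents Γ) ψ ?_ ?_⟩
  · refine hom_ext fun a => ?_
    have := toPiComponents_gen (Γ := Γ) _ ⟨a, rfl⟩
    simp only [MonoidHom.comp_apply, MonoidHom.id_apply, this, ψ]
    rw [MonoidHom.noncommPiCoprod_mulSingle, inclusion_gen]
  · refine MonoidHom.pi_ext ?_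
    intro c x
    simp only [MonoidHom.comp_apply, MonoidHom.id_apply, ψ]
    rw [MonoidHom.noncommPiCoprod_mulSingle]
    have : (toPiComponents Γ).comp (inclusion Γ c.supp) =
        MonoidHom.mulSingle (fun c : Γᶜ.ConnectedComponent => RAAG (Γ.induce c.supp)) c :=
      hom_ext fun a => by simp [toPiComponents_gen]
    exact DFunLike.congr_fun this x

end Components

/-! ### Exponent homomorphisms -/

section Exponent

open Classical in
/-- The exponent sum of a generator, as a homomorphism to the infinite cyclic group. -/
noncomputable def exponent (Γ : SimpleGraph V) (a : V) : RAAG Γ →* Multiplicative ℤ :=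
  lift (Pi.mulSingle a (Multiplicative.ofAdd 1)) fun _ _ _ => Commute.all _ _

theorem exponent_gen_self (a : V) : exponent Γ a (raagGen Γ a) = Multiplicative.ofAdd 1 := by
  simp [exponent]

theorem exponent_gen_of_ne {a b : V} (h : b ≠ a) : exponent Γ a (raagGen Γ b) = 1 := by
  simp [exponent, h]

theorem gen_ne_one (a : V) : raagGen Γ a ≠ 1 := by
  intro h
  have := exponent_gen_self (Γ := Γ) a
  rw [h, map_one] at this
  exact absurd this (by decide)

/-- A homomorphism to the integers vanishes wherever all exponents vanish. -/
theorem hom_int_eq_one [Finite V] (χ : RAAG Γ →* Multiplicative ℤ) {x : RAAG Γ}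
    (hx : ∀ a, exponent Γ a x = 1) : χ x = 1 := by
  classical
  have := Fintype.ofFinite V
  have : χ = ∏ a, (zpowGroupHom (Multiplicative.toAdd (χ (raagGen Γ a)))).comp (exponent Γ a) := by
    refine hom_ext fun b => ?_
    rw [MonoidHom.finsetProd_apply, Finset.prod_eq_single b]
    · simp only [MonoidHom.comp_apply, exponent_gen_self, zpowGroupHom_apply]
      rw [← ofAdd_zsmul]
      simp
    · intro a _ h
      simp [exponent_gen_of_ne h.symm]
    · simp
  rw [this, MonoidHom.finsetProd_apply]
  exact Finset.prod_eq_one fun a _ => by simp [hx]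

end Exponent


/-! ### Homomorphisms from groups without integral characters -/

section Indicable

/-- A group without nontrivial integral characters has only trivial homomorphisms to
free groups. -/
theorem _root_.FreeGroup.hom_eq_one_of_hom_int {P X : Type*} [Group P]
    (hP : ∀ χ : P →* Multiplicative ℤ, χ = 1) (f : P →* FreeGroup X) : f = 1 := by
  have hempty : IsEmpty (IsFreeGroup.Generators f.range) := by
    refine ⟨fun a => ?_⟩
    let χ : f.range →* Multiplicative ℤ := IsFreeGroup.lift fun _ => Multiplicative.ofAdd 1
    obtain ⟨p, hp⟩ := f.rangeRestrict_surjective (IsFreeGroup.of a)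
    have h1 : χ (IsFreeGroup.of a) = Multiplicative.ofAdd 1 := IsFreeGroup.lift_of _ _
    have h2 : χ (f.rangeRestrict p) = 1 := DFunLike.congr_fun (hP (χ.comp f.rangeRestrict)) p
    rw [hp, h1] at h2
    exact absurd h2 (by decide)
  have hid : MonoidHom.id f.range = 1 := IsFreeGroup.ext_hom fun a => hempty.elim a
  ext p
  exact congrArg Subtype.val (DFunLike.congr_fun hid (f.rangeRestrict p))

/-- The action on a free group induced by a permutation action on its basis. -/
def freeGroupAut (B X : Type*) [Group B] [MulAction B X] : B →* MulAut (FreeGroup X) where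
  toFun b := FreeGroup.freeGroupCongr (MulAction.toPerm b)
  map_one' := by
    apply MulEquiv.toMonoidHom_injective
    ext x
    simp [FreeGroup.freeGroupCongr]
  map_mul' b c := by
    apply MulEquiv.toMonoidHom_injective
    ext x
    simp [FreeGroup.freeGroupCongr, mul_smul]

@[simp]
theorem freeGroupAut_of {B X : Type*} [Group B] [MulAction B X] (b : B) (x : X) :
    freeGroupAut B X b (FreeGroup.of x) = FreeGroup.of (b • x) := by
  simp [freeGroupAut, FreeGroup.freeGroupCongr]

variable (Γ) (v : V)

/-- The subgroup generated by the neighbours of a vertex, inside the group of the complement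
of that vertex. -/
def linkSubgroup : Subgroup (RAAG (Γ.induce {v}ᶜ)) :=
  Subgroup.closure (raagGen (Γ.induce {v}ᶜ) '' {a | Γ.Adj v a})

/-- The semidirect product decomposition of a right-angled Artin group along a vertex. -/
abbrev VertexProduct : Type u :=
  FreeGroup (RAAG (Γ.induce {v}ᶜ) ⧸ linkSubgroup Γ v) ⋊[freeGroupAut (RAAG (Γ.induce {v}ᶜ))
    (RAAG (Γ.induce {v}ᶜ) ⧸ linkSubgroup Γ v)] RAAG (Γ.induce {v}ᶜ)

theorem commute_inclusion_of_mem_link {b : RAAG (Γ.induce {v}ᶜ)} (hb : b ∈ linkSubgroup Γ v) :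
    Commute (inclusion Γ {v}ᶜ b) (raagGen Γ v) := by
  have : linkSubgroup Γ v ≤
      (Subgroup.centralizer {raagGen Γ v}).comap (inclusion Γ {v}ᶜ) := by
    refine (Subgroup.closure_le _).mpr ?_
    rintro _ ⟨a, ha, rfl⟩
    refine Subgroup.mem_centralizer_singleton_iff.mpr ?_
    rw [inclusion_gen]
    exact (commute_gen ha).symm.eq
  exact Subgroup.mem_centralizer_singleton_iff.mp (this hb)

/-- The conjugates of the generator at a vertex, indexed by cosets of the link subgroup. -/
def cosetConj : RAAG (Γ.induce {v}ᶜ) ⧸ linkSubgroup Γ v → RAAG Γ :=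
  Quotient.lift (fun b => inclusion Γ {v}ᶜ b * raagGen Γ v * (inclusion Γ {v}ᶜ b)⁻¹) (by
    intro b c h
    have h := commute_inclusion_of_mem_link Γ v (QuotientGroup.leftRel_apply.mp h)
    rw [map_mul, map_inv] at h
    have h' := h.eq
    have e : inclusion Γ {v}ᶜ c =
        inclusion Γ {v}ᶜ b * ((inclusion Γ {v}ᶜ b)⁻¹ * inclusion Γ {v}ᶜ c) := by group
    rw [e]
    generalize (inclusion Γ {v}ᶜ b)⁻¹ * inclusion Γ {v}ᶜ c = t at h'
    rw [mul_assoc (inclusion Γ {v}ᶜ b) t, h']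
    group)

/-- The homomorphism from the vertex decomposition to the right-angled Artin group. -/
def ofVertexProduct : VertexProduct Γ v →* RAAG Γ :=
  SemidirectProduct.lift (FreeGroup.lift (cosetConj Γ v)) (inclusion Γ {v}ᶜ) (by
    intro b
    ext x
    induction x using QuotientGroup.induction_on with
    | H c =>
      simp only [MonoidHom.comp_apply, MulEquiv.coe_toMonoidHom, freeGroupAut_of,
        FreeGroup.lift_apply_of, MulAut.conj_apply]
      change inclusion Γ {v}ᶜ (b * c) * raagGen Γ v * (inclusion Γ {v}ᶜ (b * c))⁻¹ =
        inclusion Γ {v}ᶜ b * (inclusion Γ {v}ᶜ c * raagGen Γ v * (inclusion Γ {v}ᶜ c)⁻¹) *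
          (inclusion Γ {v}ᶜ b)⁻¹
      rw [map_mul]
      group)

theorem commute_inl_inr {b : V} (h : Γ.Adj v b) (hb : b ∈ ({v}ᶜ : Set V)) :
    Commute (SemidirectProduct.inl (FreeGroup.of (QuotientGroup.mk 1)) : VertexProduct Γ v)
      (SemidirectProduct.inr (raagGen (Γ.induce {v}ᶜ) ⟨b, hb⟩)) := by
  have hmem : raagGen (Γ.induce {v}ᶜ) ⟨b, hb⟩ ∈ linkSubgroup Γ v :=
    Subgroup.subset_closure ⟨⟨b, hb⟩, h, rfl⟩
  have hfix : raagGen (Γ.induce {v}ᶜ) ⟨b, hb⟩ •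
      (QuotientGroup.mk 1 : RAAG (Γ.induce {v}ᶜ) ⧸ linkSubgroup Γ v) = QuotientGroup.mk 1 := by
    change QuotientGroup.mk (_ * 1) = _
    rw [QuotientGroup.eq]
    simpa using hmem
  apply SemidirectProduct.ext
  · simp [hfix]
  · simp

open Classical in
/-- The homomorphism from a right-angled Artin group to its decomposition along a vertex. -/
noncomputable def toVertexProduct : RAAG Γ →* VertexProduct Γ v :=
  lift (fun a => if h : a ∈ ({v}ᶜ : Set V)
    then SemidirectProduct.inr (raagGen (Γ.induce {v}ᶜ) ⟨a, h⟩)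
    else SemidirectProduct.inl (FreeGroup.of (QuotientGroup.mk 1))) (by
    intro a b hab
    by_cases ha : a ∈ ({v}ᶜ : Set V) <;> by_cases hb : b ∈ ({v}ᶜ : Set V)
    · simp only [ha, hb, dite_true]
      exact (commute_gen (Γ := Γ.induce {v}ᶜ) (a := ⟨a, ha⟩) (b := ⟨b, hb⟩) hab).map _
    · obtain rfl : b = v := by simpa using hb
      simp only [ha, hb, dite_true, dite_false]
      exact (commute_inl_inr Γ b hab.symm ha).symm
    · obtain rfl : a = v := by simpa using ha
      simp only [ha, hb, dite_true, dite_false]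
      exact commute_inl_inr Γ a hab hb
    · simp only [ha, hb, dite_false]
      exact Commute.refl _)

theorem toVertexProduct_injective : Function.Injective (toVertexProduct Γ v) := by
  have : (ofVertexProduct Γ v).comp (toVertexProduct Γ v) = MonoidHom.id _ := by
    refine hom_ext fun a => ?_
    by_cases ha : a ∈ ({v}ᶜ : Set V)
    · simp only [MonoidHom.comp_apply, toVertexProduct, lift_gen, ha, dite_true, ofVertexProduct,
        SemidirectProduct.lift_inr, inclusion_gen, MonoidHom.id_apply]
    · obtain rfl : a = v := by simpa using ha
      simp only [MonoidHom.comp_apply, toVertexProduct, lift_gen, ha, dite_false, ofVertexProduct,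
        SemidirectProduct.lift_inl, FreeGroup.lift_apply_of, MonoidHom.id_apply]
      change inclusion Γ {a}ᶜ 1 * raagGen Γ a * (inclusion Γ {a}ᶜ 1)⁻¹ = _
      simp
  exact Function.LeftInverse.injective (g := ofVertexProduct Γ v) (DFunLike.congr_fun this)

/-- A group without nontrivial integral characters has only trivial homomorphisms to
right-angled Artin groups of finite graphs. -/
theorem hom_eq_one_of_hom_int [Finite V] {P : Type*} [Group P]
    (hP : ∀ χ : P →* Multiplicative ℤ, χ = 1) (f : P →* RAAG Γ) : f = 1 := by
  induction hn : Nat.card V using Nat.strong_induction_on generalizing V with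
  | _ n ih =>
    rcases isEmpty_or_nonempty V with hV | ⟨⟨v⟩⟩
    · have hid : MonoidHom.id (RAAG Γ) = 1 := hom_ext fun a => hV.elim a
      ext p
      exact DFunLike.congr_fun hid (f p)
    · have hlt : Nat.card ({v}ᶜ : Set V) < n := by
        rw [← hn]
        exact Finite.card_subtype_lt (p := (· ∈ ({v}ᶜ : Set V))) (x := v) (by simp)
      let F := (toVertexProduct Γ v).comp f
      have hright : ∀ p, (F p).right = 1 := fun p =>
        DFunLike.congr_fun
          (ih _ hlt (Γ.induce {v}ᶜ) (SemidirectProduct.rightHom.comp F) rfl) p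
      let L : P →* FreeGroup (RAAG (Γ.induce {v}ᶜ) ⧸ linkSubgroup Γ v) :=
        { toFun := fun p => (F p).left
          map_one' := by simp
          map_mul' := fun p q => by simp [hright] }
      have hL := FreeGroup.hom_eq_one_of_hom_int hP L
      ext p
      refine toVertexProduct_injective Γ v ?_
      rw [MonoidHom.one_apply, map_one]
      exact SemidirectProduct.ext (DFunLike.congr_fun hL p) (hright p)

end Indicable

/-! ### Exponents of commuting elements -/

section Heisenberg

/-- The integral Heisenberg group, in coordinates. -/
@[ext]
structure Heisenberg where
  /-- The first coordinate. -/
  x : ℤ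
  /-- The second coordinate. -/
  y : ℤ
  /-- The central coordinate. -/
  z : ℤ

namespace Heisenberg

instance : Mul Heisenberg := ⟨fun p q => ⟨p.x + q.x, p.y + q.y, p.z + q.z + p.x * q.y⟩⟩

instance : One Heisenberg := ⟨⟨0, 0, 0⟩⟩

instance : Inv Heisenberg := ⟨fun p => ⟨-p.x, -p.y, -p.z + p.x * p.y⟩⟩

@[simp] theorem mul_x (p q : Heisenberg) : (p * q).x = p.x + q.x := rfl
@[simp] theorem mul_y (p q : Heisenberg) : (p * q).y = p.y + q.y := rfl
@[simp] theorem mul_z (p q : Heisenberg) : (p * q).z = p.z + q.z + p.x * q.y := rfl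
@[simp] theorem one_x : (1 : Heisenberg).x = 0 := rfl
@[simp] theorem one_y : (1 : Heisenberg).y = 0 := rfl
@[simp] theorem one_z : (1 : Heisenberg).z = 0 := rfl
@[simp] theorem inv_x (p : Heisenberg) : p⁻¹.x = -p.x := rfl
@[simp] theorem inv_y (p : Heisenberg) : p⁻¹.y = -p.y := rfl
@[simp] theorem inv_z (p : Heisenberg) : p⁻¹.z = -p.z + p.x * p.y := rfl

instance : Group Heisenberg :=
  Group.ofLeftAxioms
    (fun p q r => by ext <;> simp <;> ring)
    (fun p => by ext <;> simp)
    (fun p => by ext <;> simp)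

/-- The first coordinate, as a homomorphism. -/
def xHom : Heisenberg →* Multiplicative ℤ where
  toFun p := Multiplicative.ofAdd p.x
  map_one' := rfl
  map_mul' _ _ := rfl

/-- The second coordinate, as a homomorphism. -/
def yHom : Heisenberg →* Multiplicative ℤ where
  toFun p := Multiplicative.ofAdd p.y
  map_one' := rfl
  map_mul' _ _ := rfl

theorem mul_eq_mul_of_commute {p q : Heisenberg} (h : Commute p q) : p.x * q.y = q.x * p.y := by
  have := congrArg Heisenberg.z h.eq
  simp only [mul_z] at this
  linarith

end Heisenberg

/-- The integer-valued exponent sum of a generator. -/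
noncomputable def exp (a : V) (g : RAAG Γ) : ℤ := Multiplicative.toAdd (exponent Γ a g)

@[simp]
theorem exp_mul (a : V) (g h : RAAG Γ) : exp a (g * h) = exp a g + exp a h := by
  simp [exp]

theorem exp_gen_self (a : V) : exp a (raagGen Γ a) = 1 := by
  simp [exp, exponent_gen_self]

theorem exp_gen_of_ne {a b : V} (h : b ≠ a) : exp a (raagGen Γ b) = 0 := by
  simp [exp, exponent_gen_of_ne h]

/-- The exponent vectors of commuting elements are parallel in every pair of coordinates given by
distinct nonadjacent vertices. -/
theorem exp_mul_exp_of_commute {a b : V} (hab : Γᶜ.Adj a b) {g h : RAAG Γ} (hgh : Commute g h) :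
    exp a g * exp b h = exp a h * exp b g := by
  classical
  obtain ⟨hne, hnadj⟩ := (SimpleGraph.compl_adj _ _ _).mp hab
  let F : RAAG Γ →* Heisenberg :=
    lift (fun c => if c = a then ⟨1, 0, 0⟩ else if c = b then ⟨0, 1, 0⟩ else 1) (by
      intro c d hcd
      have hcd' := hcd.symm
      have := hcd.ne
      by_cases h1 : c = a <;> by_cases h2 : d = a <;> by_cases h3 : c = b <;>
        by_cases h4 : d = b <;> simp_all)
  have hx : Heisenberg.xHom.comp F = exponent Γ a := by
    refine hom_ext fun c => ?_
    by_cases h1 : c = a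
    · subst h1
      simp [F, exponent_gen_self, Heisenberg.xHom]
    · rw [exponent_gen_of_ne h1]
      by_cases h2 : c = b <;> simp [F, h1, h2, Heisenberg.xHom]
      simp [hne.symm]
  have hy : Heisenberg.yHom.comp F = exponent Γ b := by
    refine hom_ext fun c => ?_
    by_cases h1 : c = b
    · subst h1
      simp [F, exponent_gen_self, Heisenberg.yHom, hne.symm]
    · rw [exponent_gen_of_ne h1]
      by_cases h2 : c = a <;> simp [F, h1, h2, Heisenberg.yHom]
  have hx' (g) : exp a g = (F g).x := congrArg Multiplicative.toAdd (DFunLike.congr_fun hx g).symm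
  have hy' (g) : exp b g = (F g).y := congrArg Multiplicative.toAdd (DFunLike.congr_fun hy g).symm
  rw [hx', hx', hy', hy']
  exact Heisenberg.mul_eq_mul_of_commute (hgh.map F)

end Heisenberg

/-! ### Direct product decompositions -/

section Splitting

variable {G H : Type*} [Group G] [Group H]

theorem exp_zpow (a : V) (g : RAAG Γ) (n : ℤ) : exp a (g ^ n) = n * exp a g := by
  simp [exp]

theorem exp_one (a : V) : exp a (1 : RAAG Γ) = 0 := by
  simp [exp]

/-- A direct factor on which all exponents vanish is trivial. -/
theorem subsingleton_of_exp_eq_zero [Finite V] (i : H →* RAAG Γ) (r : RAAG Γ →* H)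
    (hri : ∀ h, r (i h) = h) (hexp : ∀ a h, exp a (i h) = 0) (h : H) : h = 1 := by
  have hχ : ∀ χ : H →* Multiplicative ℤ, χ = 1 := by
    intro χ
    ext h
    have := hom_int_eq_one (χ.comp r) (x := i h) fun a => hexp a h
    simpa [hri] using this
  have := DFunLike.congr_fun (hom_eq_one_of_hom_int Γ hχ i) h
  rw [← hri h, this]
  simp

theorem eq_zpow_exp [Subsingleton V] (a : V) (g : RAAG Γ) : g = raagGen Γ a ^ exp a g := by
  have : MonoidHom.id (RAAG Γ) = (zpowersHom _ (raagGen Γ a)).comp (exponent Γ a) := by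
    refine hom_ext fun b => ?_
    obtain rfl := Subsingleton.elim a b
    simp [exponent_gen_self]
  exact DFunLike.congr_fun this g

/-- Vanishing of the exponents of a direct factor spreads along edges of the complement. -/
theorem exp_eq_zero_of_adj (i : G →* RAAG Γ) (j : H →* RAAG Γ)
    (hcomm : ∀ g h, Commute (i g) (j h)) (r : RAAG Γ → G) (s : RAAG Γ → H)
    (hrs : ∀ x, i (r x) * j (s x) = x) {a b : V}
    (hab : Γᶜ.Adj a b) (ha : ∀ h, exp a (j h) = 0) (h : H) :
    exp b (j h) = 0 := by
  have h1 := congrArg (exp a) (hrs (raagGen Γ a))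
  rw [exp_mul, ha, exp_gen_self, add_zero] at h1
  have h2 := exp_mul_exp_of_commute hab (hcomm (r (raagGen Γ a)) h)
  rw [h1, ha] at h2
  linarith

/-- At a vertex with a neighbour in the complement, the exponents of one factor vanish. -/
theorem exp_eq_zero_or_of_adj (i : G →* RAAG Γ) (j : H →* RAAG Γ)
    (hcomm : ∀ g h, Commute (i g) (j h)) (r : RAAG Γ → G) (s : RAAG Γ → H)
    (hrs : ∀ x, i (r x) * j (s x) = x) {a b : V}
    (hab : Γᶜ.Adj a b) :
    (∀ g, exp a (i g) = 0) ∨ (∀ h, exp a (j h) = 0) := by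
  by_contra! hcon
  obtain ⟨⟨g, hg⟩, ⟨h, hh⟩⟩ := hcon
  have key := fun g h => exp_mul_exp_of_commute hab (hcomm g h)
  have aa := congrArg (exp a) (hrs (raagGen Γ a))
  have ab := congrArg (exp b) (hrs (raagGen Γ a))
  have ba := congrArg (exp a) (hrs (raagGen Γ b))
  have bb := congrArg (exp b) (hrs (raagGen Γ b))
  rw [exp_mul, exp_gen_self] at aa bb
  rw [exp_mul, exp_gen_of_ne hab.ne] at ab
  rw [exp_mul, exp_gen_of_ne hab.ne.symm] at ba
  have k0 := key g h
  have k1 := key g (s (raagGen Γ a))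
  have k2 := key (r (raagGen Γ a)) h
  have k3 := key g (s (raagGen Γ b))
  have k4 := key (r (raagGen Γ b)) h
  generalize exp a (i g) = p at *
  generalize exp b (i g) = q at *
  generalize exp a (j h) = c at *
  generalize exp b (j h) = d at *
  have hq : c * q = 0 := by
    rw [← eq_sub_iff_add_eq'] at aa ab
    rw [aa, ab] at k1
    linear_combination -c * k1 + p * k2 - exp a (i (r (raagGen Γ a))) * k0
  have hq : q = 0 := (mul_eq_zero.mp hq).resolve_left hh
  have hd : d = 0 := by
    rw [hq, mul_zero] at k0
    exact (mul_eq_zero.mp k0).resolve_left hg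
  rw [hq, mul_zero] at k3
  rw [hd, mul_zero] at k4
  have h3 := (mul_eq_zero.mp k3).resolve_left hg
  have h4 := (mul_eq_zero.mp k4.symm).resolve_left hh
  omega

/-- If the complement graph is preconnected, then one factor of every direct product
decomposition is trivial. -/
theorem trivial_factor_of_preconnected [Finite V] (hΓ : Γᶜ.Preconnected) (e : RAAG Γ ≃* G × H) :
    (∀ g : G, g = 1) ∨ (∀ h : H, h = 1) := by
  let i : G →* RAAG Γ := e.symm.toMonoidHom.comp (MonoidHom.inl G H)
  let j : H →* RAAG Γ := e.symm.toMonoidHom.comp (MonoidHom.inr G H)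
  let r : RAAG Γ →* G := (MonoidHom.fst G H).comp e.toMonoidHom
  let s : RAAG Γ →* H := (MonoidHom.snd G H).comp e.toMonoidHom
  have hri : ∀ g, r (i g) = g := fun g => by simp [r, i]
  have hsj : ∀ h, s (j h) = h := fun h => by simp [s, j]
  have hsi : ∀ g, s (i g) = 1 := fun g => by simp [s, i]
  have hrj : ∀ h, r (j h) = 1 := fun g => by simp [r, j]
  have hcomm : ∀ g h, Commute (i g) (j h) := fun g h =>
    (MonoidHom.commute_inl_inr g h).map e.symm.toMonoidHom
  have hrs : ∀ x, i (r x) * j (s x) = x := fun x => by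
    simp only [i, j, r, s, MonoidHom.comp_apply, ← map_mul]
    simp
  have hsr : ∀ x, j (s x) * i (r x) = x := fun x => (hcomm _ _).eq.symm.trans (hrs x)
  suffices (∀ a g, exp a (i g) = 0) ∨ (∀ a h, exp a (j h) = 0) from
    this.imp (fun h g => subsingleton_of_exp_eq_zero i r hri h g)
      (fun h g => subsingleton_of_exp_eq_zero j s hsj h g)
  rcases isEmpty_or_nonempty V with hV | ⟨⟨v⟩⟩
  · exact Or.inl fun a => hV.elim a
  have hv : (∀ g, exp v (i g) = 0) ∨ (∀ h, exp v (j h) = 0) := by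
    rcases subsingleton_or_nontrivial V with hsub | hnon
    · by_contra! hcon
      obtain ⟨⟨g, hg⟩, ⟨h, hh⟩⟩ := hcon
      have h1 := congrArg (fun x => exp v (j (s x))) (eq_zpow_exp v (i g))
      have h2 := congrArg (fun x => exp v (i (r x))) (eq_zpow_exp v (j h))
      simp only [hsi, hrj, map_one, map_zpow, exp_zpow, exp_one] at h1 h2
      have h3 := congrArg (exp v) (hrs (raagGen Γ v))
      rw [exp_mul, exp_gen_self, (mul_eq_zero.mp h1.symm).resolve_left hg,
        (mul_eq_zero.mp h2.symm).resolve_left hh] at h3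
      exact absurd h3 (by decide)
    · obtain ⟨w, hw⟩ := SimpleGraph.Preconnected.exists_adj_of_nontrivial hΓ v
      exact exp_eq_zero_or_of_adj i j hcomm r s hrs hw
  have spread : ∀ P : V → Prop, (∀ a b, Γᶜ.Adj a b → P a → P b) → P v → ∀ a, P a := by
    intro P hP hPv a
    clear hv
    obtain ⟨p⟩ := hΓ v a
    induction p with
    | nil => exact hPv
    | cons hadj _ ih => exact ih (hP _ _ hadj hPv)
  refine hv.imp (spread _ fun a b hab h => ?_) (spread _ fun a b hab h => ?_)
  · exact exp_eq_zero_of_adj j i (fun h g => (hcomm g h).symm) s r hsr hab h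
  · exact exp_eq_zero_of_adj i j hcomm r s hrs hab h

/-- If the complement graph is disconnected, then the group splits as a direct product. -/
theorem exists_splitting_of_not_preconnected [Finite V] (hΓ : ¬ Γᶜ.Preconnected) :
    ∃ (G H : Type u) (_ : Group G) (_ : Group H),
      (∃ g : G, g ≠ 1) ∧ (∃ h : H, h ≠ 1) ∧ Nonempty (RAAG Γ ≃* (G × H)) := by
  classical
  obtain ⟨a, b, hab⟩ : ∃ a b, ¬ Γᶜ.Reachable a b := by
    simpa [SimpleGraph.Preconnected] using hΓ
  have hne : Γᶜ.connectedComponentMk b ≠ Γᶜ.connectedComponentMk a := fun h =>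
    hab (SimpleGraph.ConnectedComponent.exact h.symm)
  obtain ⟨e⟩ := nonempty_equiv_pi Γ
  let A : Γᶜ.ConnectedComponent → Type u := fun c => RAAG (Γ.induce c.supp)
  let split : (∀ c, A c) ≃* A (Γᶜ.connectedComponentMk a) ×
      ∀ c : {c // c ≠ Γᶜ.connectedComponentMk a}, A c :=
    { Equiv.piSplitAt (Γᶜ.connectedComponentMk a) A with map_mul' := fun _ _ => rfl }
  refine ⟨A (Γᶜ.connectedComponentMk a), ∀ c : {c // c ≠ Γᶜ.connectedComponentMk a}, A c,
    inferInstance, inferInstance, ⟨raagGen _ ⟨a, rfl⟩, gen_ne_one _⟩,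
    ⟨Pi.mulSingle ⟨Γᶜ.connectedComponentMk b, hne⟩ (raagGen _ ⟨b, rfl⟩), ?_⟩, ⟨e.trans split⟩⟩
  rw [Ne, Pi.mulSingle_eq_one_iff]
  exact gen_ne_one _

end Splitting

end RAAG

/-- For a finite graph `Γ`, `A(Γ)` is the direct product of the RAAGs of the induced
subgraphs of `Γ` on the connected components of the opposite graph `Γᶜ`; and `A(Γ)`
splits non-trivially as a direct product iff `Γᶜ` is disconnected. -/
theorem raag_prod_opp_components {V : Type u} [Fintype V] (Γ : SimpleGraph V) :
    Nonempty (RAAG Γ ≃*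
        ∀ c : Γᶜ.ConnectedComponent, RAAG (Γ.induce c.supp)) ∧
    ((∃ (G H : Type u) (_ : Group G) (_ : Group H),
        (∃ g : G, g ≠ 1) ∧ (∃ h : H, h ≠ 1) ∧ Nonempty (RAAG Γ ≃* (G × H))) ↔
      ¬ Γᶜ.Preconnected) := by
  refine ⟨RAAG.nonempty_equiv_pi Γ, ?_, RAAG.exists_splitting_of_not_preconnected⟩
  rintro ⟨G, H, _, _, ⟨g, hg⟩, ⟨h, hh⟩, ⟨e⟩⟩ hΓ
  exact (RAAG.trivial_factor_of_preconnected hΓ e).elim (fun H => hg (H g)) fun H => hh (H h)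
end

section
/- Let Γ be a simple graph. For every element g of A(Γ), there exists a cyclically graphically reduced word w over V(Γ) ⊔ V(Γ)⁻¹ such that g is conjugate in A(Γ) to the element represented by w; moreover w is unique up to shufflings and cyclic permutations, i.e. any two cyclically graphically reduced words representing conjugates of g are related by a finite sequence of shufflings and cyclic permutations. -/
open Relation

universe u

/-- The element of `RAAG Γ` represented by a word over `V(Γ) ⊔ V(Γ)⁻¹`. -/
def wordProd {V : Type u} (Γ : SimpleGraph V) (w : List (V × Bool)) : RAAG Γ :=
  (w.map fun p => if p.2 then raagGen Γ p.1 else (raagGen Γ p.1)⁻¹).prod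

/-- A shuffling swaps two consecutive letters whose vertices are adjacent. -/
def Shuffle {V : Type u} (Γ : SimpleGraph V) (w w' : List (V × Bool)) : Prop :=
  ∃ (l₁ l₂ : List (V × Bool)) (a b : V × Bool),
    Γ.Adj a.1 b.1 ∧ w = l₁ ++ a :: b :: l₂ ∧ w' = l₁ ++ b :: a :: l₂

/-- A free reduction deletes a consecutive pair of letters `u^ε u^(-ε)`. -/
def FreeRed {V : Type u} (_Γ : SimpleGraph V) (w w' : List (V × Bool)) : Prop :=
  ∃ (l₁ l₂ : List (V × Bool)) (u : V) (b : Bool),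
    w = l₁ ++ (u, b) :: (u, !b) :: l₂ ∧ w' = l₁ ++ l₂

/-- A word is graphically reduced if it cannot be shortened by finitely many
shufflings and free reductions. -/
def GraphReduced {V : Type u} (Γ : SimpleGraph V) (w : List (V × Bool)) : Prop :=
  ¬ ∃ w' : List (V × Bool),
    ReflTransGen (fun x y => Shuffle Γ x y ∨ FreeRed Γ x y) w w' ∧ w'.length < w.length

/-- A cyclic permutation of a word. -/
def CyclicPerm {V : Type u} (w w' : List (V × Bool)) : Prop :=
  ∃ l₁ l₂ : List (V × Bool), w = l₁ ++ l₂ ∧ w' = l₂ ++ l₁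

/-- A word is cyclically graphically reduced if it is graphically reduced and no
letter `u^ε` can be shuffled to the beginning while `u^(-ε)` is shuffled to the
end of the word. -/
def CyclicallyReduced {V : Type u} (Γ : SimpleGraph V) (w : List (V × Bool)) : Prop :=
  GraphReduced Γ w ∧
    ¬ ∃ (u : V) (b : Bool) (m : List (V × Bool)),
      ReflTransGen (Shuffle Γ) w ((u, b) :: (m ++ [(u, !b)]))

namespace RightAngledArtin

variable {V : Type u} {Γ : SimpleGraph V}

/-- The inverse of a letter. -/
def letterInv (a : V × Bool) : V × Bool := (a.1, !a.2)

@[simp] lemma letterInv_fst (a : V × Bool) : (letterInv a).1 = a.1 := rfl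

@[simp] lemma letterInv_letterInv (a : V × Bool) : letterInv (letterInv a) = a := by
  simp [letterInv]

/-- The formal inverse of a word. -/
def wordInv (w : List (V × Bool)) : List (V × Bool) := (w.map letterInv).reverse

/-! ### Trace equivalence -/

open Classical in
/-- Two words are trace equivalent if their projections to all pairs of non-adjacent (possibly
equal) vertices agree; this characterizes being related by shufflings. -/
def TraceEq (Γ : SimpleGraph V) (w w' : List (V × Bool)) : Prop :=
  ∀ u v : V, ¬ Γ.Adj u v →
    w.filter (fun p => p.1 = u ∨ p.1 = v) = w'.filter (fun p => p.1 = u ∨ p.1 = v)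

namespace TraceEq

variable {x y z x' y' : List (V × Bool)} {s : V × Bool}

lemma refl (x : List (V × Bool)) : TraceEq Γ x x := fun _ _ _ => rfl

lemma symm (h : TraceEq Γ x y) : TraceEq Γ y x := fun u v huv => (h u v huv).symm

lemma trans (h : TraceEq Γ x y) (h' : TraceEq Γ y z) : TraceEq Γ x z :=
  fun u v huv => (h u v huv).trans (h' u v huv)

lemma append (h : TraceEq Γ x y) (h' : TraceEq Γ x' y') : TraceEq Γ (x ++ x') (y ++ y') :=
  fun u v huv => by rw [List.filter_append, List.filter_append, h u v huv, h' u v huv]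

lemma cons (s : V × Bool) (h : TraceEq Γ x y) : TraceEq Γ (s :: x) (s :: y) :=
  append (refl [s]) h

lemma cancel_left (h : TraceEq Γ (z ++ x) (z ++ y)) : TraceEq Γ x y := fun u v huv => by
  simpa only [List.filter_append, List.append_cancel_left_eq] using h u v huv

lemma cancel_cons (h : TraceEq Γ (s :: x) (s :: y)) : TraceEq Γ x y :=
  cancel_left (z := [s]) h

lemma reverse (h : TraceEq Γ x y) : TraceEq Γ x.reverse y.reverse := fun u v huv => by
  rw [List.filter_reverse, List.filter_reverse, h u v huv]

lemma map_letterInv (h : TraceEq Γ x y) : TraceEq Γ (x.map letterInv) (y.map letterInv) :=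
  fun u v huv => by
    have := congrArg (List.map letterInv) (h u v huv)
    simp only [List.filter_map, Function.comp_def, letterInv_fst]
    exact this

lemma wordInv (h : TraceEq Γ x y) : TraceEq Γ (wordInv x) (wordInv y) := h.map_letterInv.reverse

lemma swap {s t : V × Bool} (h : Γ.Adj s.1 t.1) (x : List (V × Bool)) :
    TraceEq Γ (s :: t :: x) (t :: s :: x) := fun u v huv => by
  by_cases hs : s.1 = u ∨ s.1 = v
  · by_cases ht : t.1 = u ∨ t.1 = v
    · exfalso
      rcases hs with hs | hs <;> rcases ht with ht | ht <;> subst hs <;>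
        first
        | (rw [ht] at h; exact h.ne rfl)
        | (rw [ht] at h; exact huv h)
        | (rw [ht] at h; exact huv h.symm)
    · simp [hs, ht]
  · simp [List.filter_cons, hs]

lemma move_front (h : ∀ a ∈ x, Γ.Adj s.1 a.1) (y : List (V × Bool)) :
    TraceEq Γ (x ++ s :: y) (s :: (x ++ y)) := by
  induction x with
  | nil => exact refl _
  | cons a x ih =>
    simp only [List.mem_cons, forall_eq_or_imp] at h
    exact ((ih h.2).cons a).trans (swap h.1.symm _)

lemma exists_front (h : TraceEq Γ (s :: x) y) :
    ∃ l₁ l₂, y = l₁ ++ s :: l₂ ∧ (∀ a ∈ l₁, Γ.Adj s.1 a.1) ∧ TraceEq Γ x (l₁ ++ l₂) := by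
  classical
  have key : ∀ l : List (V × Bool),
      (∀ v, ¬ Γ.Adj s.1 v → ∃ r, l.filter (fun p => p.1 = s.1 ∨ p.1 = v) = s :: r) →
      ∃ l₁ l₂, l = l₁ ++ s :: l₂ ∧ ∀ a ∈ l₁, Γ.Adj s.1 a.1 := by
    intro l
    induction l with
    | nil =>
      intro H
      obtain ⟨r, hr⟩ := H s.1 (Γ.loopless.irrefl _)
      simp at hr
    | cons a l ih =>
      intro H
      by_cases has : a = s
      · exact ⟨[], l, by simp [has], by simp⟩
      by_cases hadj : Γ.Adj s.1 a.1
      · obtain ⟨l₁, l₂, rfl, hl⟩ := ih fun v hv => by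
          obtain ⟨r, hr⟩ := H v hv
          have h1 : ¬ (a.1 = s.1 ∨ a.1 = v) := by
            rintro (h | h)
            · exact hadj.ne h.symm
            · exact hv (h ▸ hadj)
          exact ⟨r, by simpa [List.filter_cons, h1] using hr⟩
        exact ⟨a :: l₁, l₂, rfl, List.forall_mem_cons.2 ⟨hadj, hl⟩⟩
      · obtain ⟨r, hr⟩ := H a.1 hadj
        simp [has] at hr
  obtain ⟨l₁, l₂, rfl, hl⟩ := key y fun v hv => ⟨_, by rw [← h s.1 v hv]; simp; rfl⟩
  exact ⟨l₁, l₂, rfl, hl, (h.trans (move_front hl l₂)).cancel_cons⟩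

/-- A letter at the beginning of a product can be found in the first factor, or else it commutes
with the first factor and is found in the second. -/
lemma front_append (h : TraceEq Γ (s :: z) (x ++ y)) :
    (∃ x', TraceEq Γ x (s :: x') ∧ TraceEq Γ z (x' ++ y)) ∨
      ((∀ a ∈ x, Γ.Adj s.1 a.1) ∧ ∃ y', TraceEq Γ y (s :: y') ∧ TraceEq Γ z (x ++ y')) := by
  obtain ⟨l₁, l₂, he, hl, hz⟩ := h.exists_front
  have second : ∀ c, l₁ = x ++ c → y = c ++ s :: l₂ →
      ((∀ a ∈ x, Γ.Adj s.1 a.1) ∧ ∃ y', TraceEq Γ y (s :: y') ∧ TraceEq Γ z (x ++ y')) := by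
    rintro c rfl rfl
    refine ⟨fun a ha => hl a (by simp [ha]), c ++ l₂,
      move_front (fun a ha => hl a (by simp [ha])) l₂, by simpa using hz⟩
  rcases List.append_eq_append_iff.1 he with ⟨c, h1, h2⟩ | ⟨c, h1, h2⟩
  · exact Or.inr (second c h1 h2)
  · cases c with
    | nil => exact Or.inr (second [] (by simpa using h1.symm) (by simpa using h2.symm))
    | cons a c =>
      obtain ⟨rfl, rfl⟩ : s = a ∧ l₂ = c ++ y := by simpa using h2
      subst h1
      exact Or.inl ⟨l₁ ++ c, move_front hl c, by simpa using hz⟩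

lemma back_append (h : TraceEq Γ (z ++ [s]) (x ++ y)) :
    (∃ y', TraceEq Γ y (y' ++ [s]) ∧ TraceEq Γ z (x ++ y')) ∨
      ((∀ a ∈ y, Γ.Adj s.1 a.1) ∧ ∃ x', TraceEq Γ x (x' ++ [s]) ∧ TraceEq Γ z (x' ++ y)) := by
  have h' : TraceEq Γ (s :: z.reverse) (y.reverse ++ x.reverse) := by simpa using h.reverse
  rcases h'.front_append with ⟨y', h1, h2⟩ | ⟨h1, x', h2, h3⟩
  · exact Or.inl ⟨y'.reverse, by simpa using h1.reverse, by simpa using h2.reverse⟩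
  · exact Or.inr ⟨by simpa using h1, x'.reverse, by simpa using h2.reverse,
      by simpa using h3.reverse⟩

lemma front_cons {t : V × Bool} (h : TraceEq Γ (s :: z) (t :: y)) :
    (s = t ∧ TraceEq Γ z y) ∨
      (Γ.Adj s.1 t.1 ∧ ∃ y', TraceEq Γ y (s :: y') ∧ TraceEq Γ z (t :: y')) := by
  obtain ⟨l₁, l₂, he, hl, hz⟩ := h.exists_front
  cases l₁ with
  | nil =>
    obtain ⟨rfl, rfl⟩ : t = s ∧ y = l₂ := by simpa using he
    exact Or.inl ⟨rfl, hz⟩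
  | cons a l₁ =>
    obtain ⟨rfl, rfl⟩ : t = a ∧ y = l₁ ++ s :: l₂ := by simpa using he
    exact Or.inr ⟨hl _ (by simp), l₁ ++ l₂, move_front (fun a ha => hl a (by simp [ha])) l₂, hz⟩

end TraceEq

lemma TraceEq.of_shuffle {x y : List (V × Bool)} (h : Shuffle Γ x y) : TraceEq Γ x y := by
  obtain ⟨l₁, l₂, a, b, hab, rfl, rfl⟩ := h
  exact (TraceEq.refl l₁).append (TraceEq.swap hab l₂)

lemma TraceEq.of_shuffles {x y : List (V × Bool)} (h : ReflTransGen (Shuffle Γ) x y) :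
    TraceEq Γ x y := by
  induction h with
  | refl => exact TraceEq.refl _
  | tail _ h ih => exact ih.trans (TraceEq.of_shuffle h)

lemma shuffles_cons (s : V × Bool) {x y : List (V × Bool)} (h : ReflTransGen (Shuffle Γ) x y) :
    ReflTransGen (Shuffle Γ) (s :: x) (s :: y) := by
  refine ReflTransGen.lift (s :: ·) ?_ _ _ h
  rintro _ _ ⟨l₁, l₂, a, b, hab, rfl, rfl⟩
  exact ⟨s :: l₁, l₂, a, b, hab, rfl, rfl⟩

lemma shuffles_move_back {s : V × Bool} {x : List (V × Bool)} (h : ∀ a ∈ x, Γ.Adj s.1 a.1)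
    (y : List (V × Bool)) : ReflTransGen (Shuffle Γ) (s :: (x ++ y)) (x ++ s :: y) := by
  induction x with
  | nil => exact ReflTransGen.refl
  | cons a x ih =>
    simp only [List.mem_cons, forall_eq_or_imp] at h
    exact ReflTransGen.head ⟨[], x ++ y, s, a, h.1, rfl, rfl⟩ (shuffles_cons a (ih h.2))

lemma TraceEq.shuffles {x y : List (V × Bool)} (h : TraceEq Γ x y) :
    ReflTransGen (Shuffle Γ) x y := by
  induction x generalizing y with
  | nil =>
    cases y with
    | nil => exact ReflTransGen.refl
    | cons a y =>
      have := h a.1 a.1 (Γ.loopless.irrefl _)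
      simp at this
  | cons s x ih =>
    obtain ⟨l₁, l₂, rfl, hl, hx⟩ := h.exists_front
    exact (shuffles_cons s (ih hx)).trans (shuffles_move_back hl l₂)

lemma traceEq_iff_shuffles {x y : List (V × Bool)} :
    TraceEq Γ x y ↔ ReflTransGen (Shuffle Γ) x y :=
  ⟨TraceEq.shuffles, TraceEq.of_shuffles⟩

lemma length_eq_of_shuffle {x y : List (V × Bool)} (h : Shuffle Γ x y) :
    x.length = y.length := by
  obtain ⟨l₁, l₂, a, b, hab, rfl, rfl⟩ := h
  simp

lemma TraceEq.length_eq {x y : List (V × Bool)} (h : TraceEq Γ x y) : x.length = y.length := by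
  induction h.shuffles with
  | refl => rfl
  | tail hxy hyz ih => exact (ih (TraceEq.of_shuffles hxy)).trans (length_eq_of_shuffle hyz)

/-! ### Reduced words -/

/-- No word in the trace class of `w` has two consecutive mutually inverse letters. -/
def Reduced (Γ : SimpleGraph V) (w : List (V × Bool)) : Prop :=
  ∀ l₁ l₂ s, ¬ TraceEq Γ w (l₁ ++ s :: letterInv s :: l₂)

lemma Reduced.congr {x y : List (V × Bool)} (hx : Reduced Γ x) (h : TraceEq Γ x y) :
    Reduced Γ y := fun l₁ l₂ s hy => hx l₁ l₂ s (h.trans hy)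

lemma Reduced.graphReduced {w : List (V × Bool)} (hw : Reduced Γ w) : GraphReduced Γ w := by
  rintro ⟨w', h, hlt⟩
  have : TraceEq Γ w w' := by
    clear hlt
    induction h with
    | refl => exact TraceEq.refl _
    | tail _ h ih =>
      rcases h with h | ⟨l₁, l₂, u, b, rfl, rfl⟩
      · exact ih.trans (TraceEq.of_shuffle h)
      · exact absurd ih (hw l₁ l₂ (u, b))
  exact hlt.ne this.length_eq.symm

lemma _root_.GraphReduced.reduced {w : List (V × Bool)} (hw : GraphReduced Γ w) :
    Reduced Γ w := fun l₁ l₂ s h => hw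
  ⟨l₁ ++ l₂, (ReflTransGen.mono (fun _ _ => Or.inl) _ _ h.shuffles).tail
    (Or.inr ⟨l₁, l₂, s.1, s.2, rfl, rfl⟩), by rw [h.length_eq]; simp⟩

lemma Reduced.of_append_right {x y : List (V × Bool)} (h : Reduced Γ (x ++ y)) : Reduced Γ y :=
  fun l₁ l₂ s hy => h (x ++ l₁) l₂ s (by simpa using (TraceEq.refl x).append hy)

lemma Reduced.tail {s : V × Bool} {x : List (V × Bool)} (h : Reduced Γ (s :: x)) : Reduced Γ x :=
  Reduced.of_append_right (x := [s]) h

lemma reduced_nil : Reduced Γ ([] : List (V × Bool)) := fun l₁ l₂ s h => by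
  simpa using h.length_eq

lemma reduced_singleton (s : V × Bool) : Reduced Γ [s] := fun l₁ l₂ t h => by
  have := h.length_eq
  simp at this
  omega

lemma Reduced.reverse {x : List (V × Bool)} (h : Reduced Γ x) : Reduced Γ x.reverse :=
  fun l₁ l₂ s hx => h l₂.reverse l₁.reverse (letterInv s) (by simpa using hx.reverse)

@[simp] lemma wordInv_wordInv (x : List (V × Bool)) : wordInv (wordInv x) = x := by
  simp [wordInv, Function.comp_def]

lemma Reduced.wordInv {x : List (V × Bool)} (h : Reduced Γ x) : Reduced Γ (wordInv x) :=
  fun l₁ l₂ s hx => h (RightAngledArtin.wordInv l₂) (RightAngledArtin.wordInv l₁) s (by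
    have := hx.wordInv
    rw [wordInv_wordInv] at this
    simpa [RightAngledArtin.wordInv] using this)

lemma Reduced.cons {s : V × Bool} {x : List (V × Bool)} (hx : Reduced Γ x)
    (hs : ∀ y, ¬ TraceEq Γ x (letterInv s :: y)) : Reduced Γ (s :: x) := by
  intro l₁ l₂ t h
  rcases h.front_append with ⟨l, -, h2⟩ | ⟨hl, l, h2, h3⟩
  · exact hx _ _ _ h2
  rcases h2.symm.front_cons with ⟨rfl, h4⟩ | ⟨hst, m, h4, h5⟩
  · refine hs (l₁ ++ l₂) ((h3.trans ((TraceEq.refl l₁).append h4)).trans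
      (TraceEq.move_front (by simpa using hl) _))
  rcases h4.symm.front_cons with ⟨rfl, -⟩ | ⟨-, m', h6, h7⟩
  · exact hst.ne rfl
  · exact hx l₁ m' t (h3.trans ((TraceEq.refl l₁).append (h5.trans (h7.cons t))))

/-- If a product of reduced words is not reduced, then a letter cancels between the factors. -/
lemma Reduced.append {x y : List (V × Bool)} (hx : Reduced Γ x) (hy : Reduced Γ y) :
    Reduced Γ (x ++ y) ∨
      ∃ s x' y', TraceEq Γ x (x' ++ [s]) ∧ TraceEq Γ y (letterInv s :: y') := by
  induction x with
  | nil => exact Or.inl hy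
  | cons t x ih =>
    rcases ih hx.tail with h | ⟨s, x', y', h1, h2⟩
    · by_contra! hcon
      refine hcon.1 (h.cons fun z hz => ?_)
      rcases hz.symm.front_append with ⟨x', h1, -⟩ | ⟨h1, y', h2, -⟩
      · exact hx [] x' t (h1.cons t)
      · refine hcon.2 t x y' ?_ h2
        simpa using (TraceEq.move_front (s := t) (by simpa using h1) []).symm
    · exact Or.inr ⟨s, t :: x', y', h1.cons t, h2⟩

/-! ### The action on trace classes of reduced words -/

/-- On reduced words, `LeftMul Γ s w w'` says that `w'` represents `s` times `w`. -/
def LeftMul (Γ : SimpleGraph V) (s : V × Bool) (w w' : List (V × Bool)) : Prop :=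
  TraceEq Γ w (letterInv s :: w') ∨ TraceEq Γ w' (s :: w)

lemma exists_leftMul (s : V × Bool) {w : List (V × Bool)} (hw : Reduced Γ w) :
    ∃ w', Reduced Γ w' ∧ LeftMul Γ s w w' := by
  by_cases h : ∃ y, TraceEq Γ w (letterInv s :: y)
  · obtain ⟨y, hy⟩ := h
    exact ⟨y, (hw.congr hy).tail, Or.inl hy⟩
  · exact ⟨s :: w, hw.cons (not_exists.1 h), Or.inr (TraceEq.refl _)⟩

lemma LeftMul.unique {s : V × Bool} {w x y : List (V × Bool)}
    (hx : Reduced Γ x) (hy : Reduced Γ y) (h : LeftMul Γ s w x) (h' : LeftMul Γ s w y) :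
    TraceEq Γ x y := by
  rcases h with h | h <;> rcases h' with h' | h'
  · exact (h.symm.trans h').cancel_cons
  · exact absurd (h'.trans (h.cons s)) (hy [] x s)
  · exact absurd (h.trans (h'.cons s)) (hx [] y s)
  · exact h.trans h'.symm

lemma LeftMul.symm {s : V × Bool} {w x : List (V × Bool)} (h : LeftMul Γ s w x) :
    LeftMul Γ (letterInv s) x w := by
  rcases h with h | h
  · exact Or.inr h
  · exact Or.inl (by simpa using h)

lemma LeftMul.congr_left {s : V × Bool} {w w' x : List (V × Bool)} (h : LeftMul Γ s w x)
    (hw : TraceEq Γ w w') : LeftMul Γ s w' x := by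
  rcases h with h | h
  · exact Or.inl (hw.symm.trans h)
  · exact Or.inr (h.trans (hw.cons s))

lemma LeftMul.diamond {s t : V × Bool} {w x y : List (V × Bool)} (hst : Γ.Adj s.1 t.1)
    (hx : Reduced Γ x) (hy : Reduced Γ y)
    (h : LeftMul Γ s w x) (h' : LeftMul Γ t w y) :
    ∃ z, Reduced Γ z ∧ LeftMul Γ t x z ∧ LeftMul Γ s y z := by
  rcases h with h | h <;> rcases h' with h' | h'
  · rcases (h.symm.trans h').front_cons with ⟨he, -⟩ | ⟨-, z, h1, h2⟩
    · exact absurd (congrArg Prod.fst he) hst.ne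
    · exact ⟨z, (hx.congr h2).tail, Or.inl h2, Or.inl h1⟩
  · have h2 : TraceEq Γ y (letterInv s :: t :: x) :=
      (h'.trans (h.cons t)).trans (TraceEq.swap (t := letterInv s) hst.symm _)
    exact ⟨t :: x, (hy.congr h2).tail, Or.inr (TraceEq.refl _), Or.inl h2⟩
  · have h2 : TraceEq Γ x (letterInv t :: s :: y) :=
      (h.trans (h'.cons s)).trans (TraceEq.swap (t := letterInv t) hst _)
    exact ⟨s :: y, (hx.congr h2).tail, Or.inl h2, Or.inr (TraceEq.refl _)⟩
  · refine ⟨s :: y, hy.cons fun z hz => ?_, Or.inr ?_, Or.inr (TraceEq.refl _)⟩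
    · rcases (hz.symm.trans h').front_cons with ⟨he, -⟩ | ⟨-, z', h1, -⟩
      · exact hst.ne (by rw [← he, letterInv_fst])
      · exact hx [] z' s (h.trans (h1.cons s))
    · exact ((h'.cons s).trans (TraceEq.swap hst _)).trans (h.symm.cons t)

/-- Trace equivalence of reduced words. -/
def traceSetoid (Γ : SimpleGraph V) : Setoid {w : List (V × Bool) // Reduced Γ w} where
  r x y := TraceEq Γ x.1 y.1
  iseqv := ⟨fun _ => TraceEq.refl _, TraceEq.symm, TraceEq.trans⟩

/-- Trace classes of reduced words. -/
def ReducedTrace (Γ : SimpleGraph V) : Type u := Quotient (traceSetoid Γ)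

/-- The trace class of a reduced word. -/
def ReducedTrace.mk {w : List (V × Bool)} (hw : Reduced Γ w) : ReducedTrace Γ :=
  Quotient.mk (traceSetoid Γ) ⟨w, hw⟩

lemma ReducedTrace.mk_eq {w w' : List (V × Bool)} {hw : Reduced Γ w} {hw' : Reduced Γ w'} :
    ReducedTrace.mk hw = ReducedTrace.mk hw' ↔ TraceEq Γ w w' :=
  Quotient.eq (r := traceSetoid Γ)

lemma ReducedTrace.exists_rep (x : ReducedTrace Γ) :
    ∃ (w : List (V × Bool)) (hw : Reduced Γ w), ReducedTrace.mk hw = x := by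
  obtain ⟨⟨w, hw⟩, rfl⟩ := Quotient.exists_rep x
  exact ⟨w, hw, rfl⟩

/-- Left multiplication by a letter on trace classes of reduced words. -/
noncomputable def push (s : V × Bool) (x : ReducedTrace Γ) : ReducedTrace Γ :=
  ReducedTrace.mk (exists_leftMul s (Quotient.out x).2).choose_spec.1

lemma push_mk {s : V × Bool} {w w' : List (V × Bool)} (hw : Reduced Γ w) (hw' : Reduced Γ w')
    (h : LeftMul Γ s w w') : push s (ReducedTrace.mk hw) = ReducedTrace.mk hw' := by
  refine ReducedTrace.mk_eq.2 (LeftMul.unique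
    (exists_leftMul s (Quotient.out (ReducedTrace.mk hw)).2).choose_spec.1 hw'
    (exists_leftMul s (Quotient.out (ReducedTrace.mk hw)).2).choose_spec.2 (h.congr_left ?_))
  exact (ReducedTrace.mk_eq (hw := hw) (hw' := (Quotient.out (ReducedTrace.mk hw)).2)).1
    (Quotient.out_eq (ReducedTrace.mk hw)).symm

lemma push_letterInv (s : V × Bool) (x : ReducedTrace Γ) : push (letterInv s) (push s x) = x := by
  obtain ⟨w, hw, rfl⟩ := x.exists_rep
  obtain ⟨w', hw', h⟩ := exists_leftMul s hw
  rw [push_mk hw hw' h, push_mk hw' hw h.symm]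

lemma push_comm {s t : V × Bool} (hst : Γ.Adj s.1 t.1) (x : ReducedTrace Γ) :
    push s (push t x) = push t (push s x) := by
  obtain ⟨w, hw, rfl⟩ := x.exists_rep
  obtain ⟨x, hx, h⟩ := exists_leftMul s hw
  obtain ⟨y, hy, h'⟩ := exists_leftMul t hw
  obtain ⟨z, hz, h1, h2⟩ := h.diamond hst hx hy h'
  rw [push_mk hw hx h, push_mk hw hy h', push_mk hx hz h1, push_mk hy hz h2]

/-- Left multiplication by a vertex as a permutation. -/
noncomputable def pushPerm (Γ : SimpleGraph V) (u : V) : Equiv.Perm (ReducedTrace Γ) where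
  toFun := push (u, true)
  invFun := push (u, false)
  left_inv := push_letterInv (u, true)
  right_inv := push_letterInv (u, false)

/-- The action of the right-angled Artin group on trace classes of reduced words. -/
noncomputable def raagAction (Γ : SimpleGraph V) : RAAG Γ →* Equiv.Perm (ReducedTrace Γ) :=
  PresentedGroup.toGroup (f := pushPerm Γ) (by
    rintro r ⟨u, v, huv, rfl⟩
    simp only [map_mul, map_inv, FreeGroup.lift_apply_of]
    rw [mul_inv_eq_one, mul_inv_eq_iff_eq_mul]
    ext x
    exact push_comm (s := (u, true)) (t := (v, true)) huv x)

/-! ### Elements represented by words -/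

@[simp] lemma wordProd_nil : wordProd Γ [] = 1 := rfl

lemma wordProd_append (x y : List (V × Bool)) :
    wordProd Γ (x ++ y) = wordProd Γ x * wordProd Γ y := by
  simp [wordProd]

lemma wordProd_cons (s : V × Bool) (x : List (V × Bool)) :
    wordProd Γ (s :: x) = wordProd Γ [s] * wordProd Γ x :=
  wordProd_append [s] x

lemma wordProd_letterInv (s : V × Bool) : wordProd Γ [letterInv s] = (wordProd Γ [s])⁻¹ := by
  obtain ⟨u, b⟩ := s
  cases b <;> simp [wordProd, letterInv]

lemma wordProd_wordInv (x : List (V × Bool)) : wordProd Γ (wordInv x) = (wordProd Γ x)⁻¹ := by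
  induction x with
  | nil => simp [wordInv]
  | cons s x ih =>
    have : wordInv (s :: x) = wordInv x ++ [letterInv s] := by simp [wordInv]
    rw [this, wordProd_append, ih, wordProd_letterInv, wordProd_cons s x, mul_inv_rev]

lemma raagGen_commute {u v : V} (h : Γ.Adj u v) : Commute (raagGen Γ u) (raagGen Γ v) := by
  have : PresentedGroup.mk (raagRels Γ) (FreeGroup.of u * FreeGroup.of v *
      (FreeGroup.of u)⁻¹ * (FreeGroup.of v)⁻¹) = 1 :=
    PresentedGroup.one_of_mem ⟨u, v, h, rfl⟩
  rw [map_mul, map_inv, mul_inv_eq_one, map_mul, map_inv, mul_inv_eq_iff_eq_mul, map_mul] at this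
  exact this

lemma wordProd_commute {s t : V × Bool} (h : Γ.Adj s.1 t.1) :
    Commute (wordProd Γ [s]) (wordProd Γ [t]) := by
  obtain ⟨u, b⟩ := s
  obtain ⟨v, c⟩ := t
  have := raagGen_commute h
  cases b <;> cases c <;> simpa [wordProd] using this

lemma TraceEq.wordProd_eq {x y : List (V × Bool)} (h : TraceEq Γ x y) :
    wordProd Γ x = wordProd Γ y := by
  induction h.shuffles with
  | refl => rfl
  | tail h' h'' ih =>
    rw [ih (TraceEq.of_shuffles h')]
    obtain ⟨l₁, l₂, a, b, hab, rfl, rfl⟩ := h''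
    have : wordProd Γ [a, b] = wordProd Γ [b, a] := by
      rw [wordProd_cons a [b], wordProd_cons b [a], (wordProd_commute hab).eq]
    rw [wordProd_append, wordProd_append]
    exact congrArg _ ((wordProd_append [a, b] l₂).trans
      ((congrArg (· * _) this).trans (wordProd_append [b, a] l₂).symm))

lemma wordProd_surjective (g : RAAG Γ) : ∃ w, wordProd Γ w = g := by
  induction g using PresentedGroup.induction_on with
  | _ z =>
    induction z using FreeGroup.induction_on with
    | C1 => exact ⟨[], by simp⟩
    | of u => exact ⟨[(u, true)], by simp [wordProd, raagGen]; rfl⟩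
    | inv_of u _ => exact ⟨[(u, false)], by simp [wordProd, raagGen]; rfl⟩
    | mul x y hx hy =>
      obtain ⟨a, ha⟩ := hx
      obtain ⟨b, hb⟩ := hy
      exact ⟨a ++ b, by rw [wordProd_append, ha, hb, map_mul]⟩

lemma raagAction_letter (s : V × Bool) (x : ReducedTrace Γ) :
    raagAction Γ (wordProd Γ [s]) x = push s x := by
  obtain ⟨u, b⟩ := s
  have h : raagAction Γ (raagGen Γ u) = pushPerm Γ u := PresentedGroup.toGroup.of _
  cases b
  · simp only [wordProd, List.map_cons, List.map_nil, List.prod_singleton, Bool.false_eq_true,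
      if_false, map_inv, h]
    rfl
  · simp only [wordProd, List.map_cons, List.map_nil, List.prod_singleton, if_true, h]
    rfl

lemma raagAction_wordProd {w : List (V × Bool)} (hw : Reduced Γ w) :
    raagAction Γ (wordProd Γ w) (ReducedTrace.mk reduced_nil) = ReducedTrace.mk hw := by
  induction w with
  | nil => simp
  | cons s w ih =>
    rw [wordProd_cons, map_mul, Equiv.Perm.mul_apply, ih hw.tail, raagAction_letter]
    exact push_mk _ _ (Or.inr (TraceEq.refl _))

/-- Reduced words representing the same element are trace equivalent. -/
lemma Reduced.traceEq {x y : List (V × Bool)} (hx : Reduced Γ x) (hy : Reduced Γ y)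
    (h : wordProd Γ x = wordProd Γ y) : TraceEq Γ x y :=
  ReducedTrace.mk_eq.1 (by rw [← raagAction_wordProd hx, h, raagAction_wordProd hy])

/-! ### Cyclically reduced words -/

/-- Cyclic reducedness, phrased with trace equivalence. -/
def CycReduced (Γ : SimpleGraph V) (w : List (V × Bool)) : Prop :=
  Reduced Γ w ∧ ∀ s m, ¬ TraceEq Γ w (s :: (m ++ [letterInv s]))

lemma cyclicallyReduced_iff {w : List (V × Bool)} :
    CyclicallyReduced Γ w ↔ CycReduced Γ w := by
  refine and_congr ⟨GraphReduced.reduced, Reduced.graphReduced⟩ ?_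
  simp only [← traceEq_iff_shuffles, not_exists, Prod.forall, letterInv]

lemma CycReduced.reverse {w : List (V × Bool)} (hw : CycReduced Γ w) :
    CycReduced Γ w.reverse :=
  ⟨hw.1.reverse, fun s m h => hw.2 (letterInv s) m.reverse (by simpa using h.reverse)⟩

lemma CycReduced.rotate {w x : List (V × Bool)} {s : V × Bool} (hw : CycReduced Γ w)
    (h : TraceEq Γ w (s :: x)) : CycReduced Γ (x ++ [s]) := by
  refine ⟨?_, fun t m ht => ?_⟩
  · rcases (hw.1.congr h).tail.append (reduced_singleton s) with h1 | ⟨t, x', y', h1, h2⟩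
    · exact h1
    · rcases h2.symm.front_cons with ⟨he, -⟩ | ⟨-, y, h3, -⟩
      · have : t = letterInv s := by rw [← he, letterInv_letterInv]
        subst this
        exact absurd (h.trans (h1.cons s)) (hw.2 s x')
      · simpa using h3.length_eq
  · rcases TraceEq.back_append (z := t :: m) (s := letterInv t) ht.symm with
      ⟨y, h1, h2⟩ | ⟨h1, y, h2, h3⟩
    · have hy : y = [] := by simpa using h1.length_eq
      subst hy
      rcases h1.front_cons with ⟨rfl, -⟩ | ⟨-, y, h3, -⟩
      · rw [List.append_nil] at h2
        exact hw.1 [] m (letterInv t) (by simpa using h.trans (h2.symm.cons _))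
      · simpa using h3.length_eq
    · have hts : Γ.Adj t.1 s.1 := by simpa using h1
      rcases h3.front_append with ⟨z, h4, -⟩ | ⟨-, z, h4, -⟩
      · exact hw.2 t (s :: z) (((h.trans (h2.cons s)).trans
          ((h4.append (TraceEq.refl _)).cons s)).trans (TraceEq.swap hts.symm _))
      · rcases h4.front_cons with ⟨rfl, -⟩ | ⟨-, y, -, h5⟩
        · exact hts.ne rfl
        · simpa using h5.length_eq

lemma CycReduced.rotate_back {w x : List (V × Bool)} {s : V × Bool} (hw : CycReduced Γ w)
    (h : TraceEq Γ w (x ++ [s])) : CycReduced Γ (s :: x) := by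
  have : TraceEq Γ w.reverse (s :: x.reverse) := by simpa using h.reverse
  simpa using (hw.reverse.rotate this).reverse

/-- Being related by shufflings and cyclic permutations. -/
abbrev CycEquiv (Γ : SimpleGraph V) : List (V × Bool) → List (V × Bool) → Prop :=
  EqvGen (fun x y => Shuffle Γ x y ∨ CyclicPerm x y)

lemma TraceEq.cycEquiv {x y : List (V × Bool)} (h : TraceEq Γ x y) : CycEquiv Γ x y := by
  induction h.shuffles with
  | refl => exact EqvGen.refl _
  | tail h' h'' ih => exact (ih (TraceEq.of_shuffles h')).trans _ _ _ (EqvGen.rel _ _ (Or.inl h''))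

lemma cycEquiv_append_comm (x y : List (V × Bool)) : CycEquiv Γ (x ++ y) (y ++ x) :=
  EqvGen.rel _ _ (Or.inr ⟨x, y, rfl, rfl⟩)

lemma wordProd_commute_word {s : V × Bool} {x : List (V × Bool)}
    (h : ∀ a ∈ x, Γ.Adj s.1 a.1) : Commute (wordProd Γ [s]) (wordProd Γ x) := by
  have := (TraceEq.move_front h []).wordProd_eq
  rw [wordProd_append, List.append_nil, wordProd_cons s x] at this
  exact this.symm

/-- Cyclically reduced words representing conjugate elements are related by shufflings and
cyclic permutations. -/
lemma CycReduced.cycEquiv_of_conj {g w w' : List (V × Bool)} (hw : CycReduced Γ w)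
    (hw' : CycReduced Γ w')
    (h : wordProd Γ g * wordProd Γ w * (wordProd Γ g)⁻¹ = wordProd Γ w') :
    CycEquiv Γ w w' := by
  induction hn : g.length using Nat.strong_induction_on generalizing g w with
  | _ n ih =>
  by_cases hg : Reduced Γ g
  swap
  · simp only [Reduced, not_forall, not_not] at hg
    obtain ⟨l₁, l₂, s, hs⟩ := hg
    refine ih (l₁ ++ l₂).length ?_ hw (g := l₁ ++ l₂) ?_ rfl
    · rw [← hn, hs.length_eq]; simp
    · have : wordProd Γ g = wordProd Γ (l₁ ++ l₂) := by
        rw [hs.wordProd_eq, wordProd_append, wordProd_cons, wordProd_cons (letterInv s),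
          wordProd_letterInv, mul_inv_cancel_left, wordProd_append]
      rw [← this, h]
  have length_lt {x : List (V × Bool)} {s : V × Bool} (hx : TraceEq Γ g (x ++ [s])) :
      x.length < n := by
    rw [← hn, hx.length_eq]; simp
  rcases hg.append hw.1 with hgw | ⟨s, x, y, hx, hy⟩
  swap
  · refine (hy.cycEquiv.trans _ _ _ (cycEquiv_append_comm [letterInv s] y)).trans _ _ _
      (ih _ (length_lt hx) (hw.rotate hy) ?_ rfl)
    rw [← h, hx.wordProd_eq, hy.wordProd_eq, wordProd_cons (letterInv s), wordProd_append,
      wordProd_append, wordProd_letterInv]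
    group
  rcases hgw.append hg.wordInv with hgwg | ⟨s, x, y, hx, hy⟩
  · cases g with
    | nil => exact (hw.1.traceEq hw'.1 (by simpa using h)).cycEquiv
    | cons t g =>
      refine absurd ?_ (hw'.2 t (g ++ w ++ wordInv g))
      have := hw'.1.traceEq hgwg (by
        rw [← h, wordProd_append, wordProd_append, wordProd_wordInv])
      simpa [wordInv] using this
  have hg' : TraceEq Γ g (wordInv y ++ [s]) := by
    have := hy.wordInv
    rw [wordInv_wordInv] at this
    simpa [wordInv] using this
  rcases hx.symm.back_append with ⟨z, hz, -⟩ | ⟨hs, -⟩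
  · refine (hz.cycEquiv.trans _ _ _ (cycEquiv_append_comm z [s])).trans _ _ _
      (ih _ (length_lt hg') (hw.rotate_back hz) ?_ rfl)
    rw [← h, hg'.wordProd_eq, hz.wordProd_eq, wordProd_append, wordProd_append, wordProd_append]
    group
  · refine ih _ (length_lt hg') hw ?_ rfl
    rw [← h, hg'.wordProd_eq, wordProd_append, mul_assoc (wordProd Γ (wordInv y)) (wordProd Γ [s]),
      (wordProd_commute_word hs).eq]
    group

lemma exists_cycReduced_conj (g : RAAG Γ) :
    ∃ w, CycReduced Γ w ∧ IsConj g (wordProd Γ w) := by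
  obtain ⟨w₀, hw₀⟩ := wordProd_surjective g
  obtain ⟨w, hw, hmin⟩ := WellFounded.has_min
    (measure (List.length : List (V × Bool) → ℕ)).wf {w | IsConj g (wordProd Γ w)}
    ⟨w₀, by rw [← hw₀]; exact IsConj.refl _⟩
  refine ⟨w, ⟨fun l₁ l₂ s h => hmin (l₁ ++ l₂) ?_ ?_, fun s m h => hmin m ?_ ?_⟩, hw⟩
  · have : wordProd Γ (l₁ ++ l₂) = wordProd Γ w := by
      rw [h.wordProd_eq, wordProd_append, wordProd_append, wordProd_cons s,
        wordProd_cons (letterInv s), wordProd_letterInv, mul_inv_cancel_left]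
    change IsConj g _
    rw [this]
    exact hw
  · change (l₁ ++ l₂).length < w.length
    rw [h.length_eq]; simp
  · refine hw.trans (IsConj.symm (isConj_iff.2 ⟨wordProd Γ [s], ?_⟩))
    rw [h.wordProd_eq, wordProd_cons s (m ++ _), wordProd_append, wordProd_letterInv, mul_assoc]
  · change m.length < w.length
    rw [h.length_eq]; simp

end RightAngledArtin

/-- Every element of `A(Γ)` is conjugate to an element represented by a cyclically
graphically reduced word, unique up to shufflings and cyclic permutations. -/
theorem conjugacy_normal_form {V : Type u} (Γ : SimpleGraph V) (g : RAAG Γ) :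
    ∃ w : List (V × Bool), CyclicallyReduced Γ w ∧ IsConj g (wordProd Γ w) ∧
      ∀ w' : List (V × Bool), CyclicallyReduced Γ w' → IsConj g (wordProd Γ w') →
        Relation.EqvGen (fun x y => Shuffle Γ x y ∨ CyclicPerm x y) w w' := by
  obtain ⟨w, hw, hgw⟩ := RightAngledArtin.exists_cycReduced_conj g
  refine ⟨w, RightAngledArtin.cyclicallyReduced_iff.2 hw, hgw, fun w' hw' hgw' => ?_⟩
  obtain ⟨c, hc⟩ := isConj_iff.1 (hgw.symm.trans hgw')
  obtain ⟨k, rfl⟩ := RightAngledArtin.wordProd_surjective c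
  exact hw.cycEquiv_of_conj (RightAngledArtin.cyclicallyReduced_iff.1 hw') hc
end

section
/- Let Γ be a simple graph. Every non-trivial element of the right-angled Artin group A(Γ) belongs to a unique maximal infinite cyclic subgroup of A(Γ). -/
universe u

/-- A maximal infinite cyclic subgroup: a subgroup isomorphic to `ℤ` not properly
contained in any other subgroup isomorphic to `ℤ`. -/
def IsMaxInfCyclic {G : Type*} [Group G] (H : Subgroup G) : Prop :=
  Nonempty (H ≃* Multiplicative ℤ) ∧
    ∀ K : Subgroup G, Nonempty (K ≃* Multiplicative ℤ) → H ≤ K → H = K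

section AbstractRoots

variable {G : Type*} [Group G]

theorem nonempty_zpowers_mulEquiv_int {a : G} (ha : ¬IsOfFinOrder a) :
    Nonempty (Subgroup.zpowers a ≃* Multiplicative ℤ) := by
  have : Infinite (Subgroup.zpowers a) :=
    Set.infinite_coe_iff.mpr (infinite_zpowers.mpr ha)
  exact ⟨(intCyclicMulEquiv (G := Subgroup.zpowers a)).symm⟩

theorem Subgroup.exists_zpowers_eq_of_mulEquiv_int {H : Subgroup G}
    (hH : Nonempty (H ≃* Multiplicative ℤ)) : ∃ a, Subgroup.zpowers a = H := by
  obtain ⟨e⟩ := hH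
  exact H.isCyclic_iff_exists_zpowers_eq_top.mp (e.isCyclic.mpr inferInstance)

/-- In a group with unique roots, two elements with a common nontrivial power are powers of
a single element. -/
theorem exists_zpow_eq_of_zpow_eq_zpow
    (hroot : ∀ (a b : G) (n : ℕ), n ≠ 0 → a ^ n = b ^ n → a = b)
    {a b : G} {m n : ℤ} (hm : m ≠ 0) (h : a ^ m = b ^ n) :
    ∃ c : G, a ∈ Subgroup.zpowers c ∧ b ∈ Subgroup.zpowers c := by
  have hrootZ : ∀ (x y : G) (k : ℤ), k ≠ 0 → x ^ k = y ^ k → x = y := by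
    intro x y k hk hxy
    apply hroot x y k.natAbs (Int.natAbs_ne_zero.mpr hk)
    rcases Int.natAbs_eq k with hk' | hk' <;> rw [hk'] at hxy
    · rwa [zpow_natCast, zpow_natCast] at hxy
    · rwa [zpow_neg, zpow_neg, zpow_natCast, zpow_natCast, inv_inj] at hxy
  have hcomm : Commute a b := by
    have hconj : b * a * b⁻¹ = a := by
      apply hrootZ _ _ m hm
      rw [conj_zpow, h, mul_inv_eq_iff_eq_mul, (Commute.self_zpow b n).eq]
    exact (mul_inv_eq_iff_eq_mul.mp hconj).symm
  obtain ⟨m', n', hgcd, hm', hn'⟩ := Int.exists_gcd_one (Int.gcd_pos_of_ne_zero_left n hm)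
  have hd : (Int.gcd m n : ℤ) ≠ 0 := fun h0 ↦ hm (by rw [hm', h0, mul_zero])
  have h' : a ^ m' = b ^ n' := by
    apply hrootZ _ _ _ hd
    rw [← zpow_mul, ← zpow_mul, ← hm', ← hn', h]
  obtain ⟨s, t, hst⟩ := Int.isCoprime_iff_gcd_eq_one.mpr hgcd
  have hst' : Commute (b ^ s) (a ^ t) := (hcomm.zpow_zpow t s).symm
  refine ⟨b ^ s * a ^ t, ⟨n', ?_⟩, ⟨m', ?_⟩⟩
  · change (b ^ s * a ^ t) ^ n' = a
    rw [hst'.mul_zpow, ← zpow_mul, ← zpow_mul, mul_comm s n', zpow_mul, ← h', ← zpow_mul,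
      ← zpow_add, mul_comm m' s, hst, zpow_one]
  · change (b ^ s * a ^ t) ^ m' = b
    rw [hst'.mul_zpow, ← zpow_mul, ← zpow_mul, mul_comm t m', zpow_mul a, h', ← zpow_mul,
      ← zpow_add, mul_comm n' t, hst, zpow_one]

/-- In a group with unique roots where the exponents of roots of a nontrivial element are
bounded, every nontrivial element lies in a unique maximal infinite cyclic subgroup. -/
theorem existsUnique_isMaxInfCyclic
    (hroot : ∀ (a b : G) (n : ℕ), n ≠ 0 → a ^ n = b ^ n → a = b)
    {g : G} (hg : g ≠ 1) (hbound : ∃ N : ℕ, ∀ (h : G) (n : ℕ), h ^ n = g → n ≤ N) :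
    ∃! H : Subgroup G, g ∈ H ∧ IsMaxInfCyclic H := by
  have htf : ∀ a : G, a ≠ 1 → Nonempty (Subgroup.zpowers a ≃* Multiplicative ℤ) := by
    intro a ha
    refine nonempty_zpowers_mulEquiv_int fun hfin ↦ ha ?_
    obtain ⟨n, hn, hn1⟩ := isOfFinOrder_iff_pow_eq_one.mp hfin
    exact hroot a 1 n hn.ne' (by rw [hn1, one_pow])
  classical
  obtain ⟨N, hN⟩ := hbound
  obtain ⟨h, hh⟩ : ∃ h : G, h ^ Nat.findGreatest (fun n ↦ ∃ h : G, h ^ n = g) N = g :=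
    Nat.findGreatest_spec (P := fun n ↦ ∃ h : G, h ^ n = g) (hN g 1 (pow_one g))
      ⟨g, pow_one g⟩
  have hmax : ∀ (k : G) (j : ℕ), k ^ j = g →
      j ≤ Nat.findGreatest (fun n ↦ ∃ h : G, h ^ n = g) N :=
    fun k j hk ↦ Nat.le_findGreatest (hN k j hk) ⟨k, hk⟩
  generalize Nat.findGreatest (fun n ↦ ∃ h : G, h ^ n = g) N = n at hh hmax
  have hn0 : n ≠ 0 := by
    rintro rfl
    exact hg (by rw [← hh, pow_zero])
  have hh1 : h ≠ 1 := by
    rintro rfl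
    exact hg (by rw [← hh, one_pow])
  have hHmax : IsMaxInfCyclic (Subgroup.zpowers h) := by
    refine ⟨htf h hh1, fun K hK hle ↦ ?_⟩
    obtain ⟨k, rfl⟩ := Subgroup.exists_zpowers_eq_of_mulEquiv_int hK
    obtain ⟨j, hj⟩ : ∃ j : ℤ, k ^ j = h := hle (Subgroup.mem_zpowers h)
    have hj0 : j ≠ 0 := by
      rintro rfl
      exact hh1 (by rw [← hj, zpow_zero])
    have hle1 : j.natAbs * n ≤ n := by
      rcases Int.natAbs_eq j with hj' | hj'
      · refine hmax k _ ?_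
        rw [pow_mul, ← zpow_natCast k, ← hj', hj, hh]
      · refine hmax k⁻¹ _ ?_
        rw [pow_mul, ← zpow_natCast k⁻¹, inv_zpow', ← hj', hj, hh]
    have hj1 : j.natAbs = 1 := by
      have h1 : j.natAbs ≤ 1 :=
        Nat.le_of_mul_le_mul_right (by simpa using hle1) (Nat.pos_of_ne_zero hn0)
      have h2 := Int.natAbs_ne_zero.mpr hj0
      lia
    rcases Int.natAbs_eq_iff.mp hj1 with rfl | rfl
    · simp [← hj]
    · simp [← hj]
  refine ⟨Subgroup.zpowers h, ⟨⟨n, by simpa using hh⟩, hHmax⟩, ?_⟩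
  rintro H ⟨hgH, hH, hKmax⟩
  obtain ⟨a, rfl⟩ := Subgroup.exists_zpowers_eq_of_mulEquiv_int hH
  obtain ⟨m, hm⟩ : ∃ m : ℤ, a ^ m = g := hgH
  have hm0 : m ≠ 0 := by
    rintro rfl
    exact hg (by rw [← hm, zpow_zero])
  obtain ⟨c, hac, hhc⟩ := exists_zpow_eq_of_zpow_eq_zpow hroot hm0 (n := n)
    (hm.trans (by simpa using hh.symm))
  have hc1 : c ≠ 1 := by
    rintro rfl
    exact hh1 (by simpa using hhc)
  rw [hKmax _ (htf c hc1) (Subgroup.zpowers_le.mpr hac),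
    hHmax.2 _ (htf c hc1) (Subgroup.zpowers_le.mpr hhc)]

end AbstractRoots

section PolynomialRoots

open Polynomial

variable {B : Type*} [Ring B]

/-- The leading difference of two polynomials with constant coefficient one is multiplied
by `m` when passing to `m`-th powers. -/
theorem Polynomial.exists_pow_sub_pow_eq_X_pow_mul {a b c : B[X]} {d : ℕ}
    (ha : a.coeff 0 = 1) (hb : b.coeff 0 = 1) (hab : a - b = X ^ d * c) (m : ℕ) :
    ∃ c' : B[X], a ^ m - b ^ m = X ^ d * c' ∧ c'.coeff 0 = m • c.coeff 0 := by
  induction m with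
  | zero => exact ⟨0, by simp⟩
  | succ m ih =>
    obtain ⟨c', hc', hc0⟩ := ih
    refine ⟨a ^ m * c + c' * b, ?_, ?_⟩
    · calc a ^ (m + 1) - b ^ (m + 1) = a ^ m * (a - b) + (a ^ m - b ^ m) * b := by
            simp only [pow_succ]; noncomm_ring
        _ = X ^ d * (a ^ m * c + c' * b) := by
            rw [hab, hc', mul_add, ← mul_assoc, ← mul_assoc, ← mul_assoc, X_pow_mul (p := a ^ m)]
    · have ham : (a ^ m).coeff 0 = 1 := by
        rw [← constantCoeff_apply, map_pow, constantCoeff_apply, ha, one_pow]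
      rw [coeff_add, mul_coeff_zero, mul_coeff_zero, ham, hb, hc0, one_mul, mul_one, add_comm,
        succ_nsmul]

theorem Polynomial.exists_eq_X_pow_mul_of_ne_zero {p : B[X]} (hp : p ≠ 0) :
    ∃ (d : ℕ) (c : B[X]), p = X ^ d * c ∧ c.coeff 0 ≠ 0 := by
  obtain ⟨c, hc⟩ : X ^ p.natTrailingDegree ∣ p :=
    X_pow_dvd_iff.mpr fun _ hd ↦ coeff_eq_zero_of_lt_natTrailingDegree hd
  refine ⟨_, c, hc, fun h0 ↦ hp (trailingCoeff_eq_zero.mp ?_)⟩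
  have := coeff_X_pow_mul c p.natTrailingDegree 0
  rw [← hc, zero_add, h0] at this
  exact this

theorem Polynomial.coeff_zero_eq_of_X_pow_mul_eq {p q : B[X]} {d e : ℕ}
    (hp : p.coeff 0 ≠ 0) (hq : q.coeff 0 ≠ 0) (h : X ^ d * p = X ^ e * q) :
    p.coeff 0 = q.coeff 0 := by
  have hd := congrArg (fun r ↦ r.coeff d) h
  have he := congrArg (fun r ↦ r.coeff e) h
  simp only [coeff_X_pow_mul', le_refl, if_true, Nat.sub_self] at hd he
  rcases lt_trichotomy d e with hlt | rfl | hlt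
  · exact absurd (hd.trans (if_neg hlt.not_ge)) hp
  · simpa using hd
  · exact absurd (he.symm.trans (if_neg hlt.not_ge)) hq

theorem nsmul_ne_zero_of_separating (hB : ∀ x : B, x ≠ 0 → ∃ φ : B →+ ℤ, φ x ≠ 0) {m : ℕ}
    (hm : m ≠ 0) {x : B} (hx : x ≠ 0) : m • x ≠ 0 := by
  obtain ⟨φ, hφ⟩ := hB x hx
  intro h
  have hφm : m • φ x = 0 := by rw [← map_nsmul, h, map_zero]
  simp [hm, hφ] at hφm

theorem Polynomial.eq_of_pow_eq_pow_of_coeff_zero_eq_one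
    (hB : ∀ x : B, x ≠ 0 → ∃ φ : B →+ ℤ, φ x ≠ 0) {a b : B[X]}
    (ha : a.coeff 0 = 1) (hb : b.coeff 0 = 1) {m : ℕ} (hm : m ≠ 0) (h : a ^ m = b ^ m) :
    a = b := by
  by_contra hne
  obtain ⟨d, c, hc, hc0⟩ := exists_eq_X_pow_mul_of_ne_zero (sub_ne_zero.mpr hne)
  obtain ⟨c', hc', hc0'⟩ := exists_pow_sub_pow_eq_X_pow_mul ha hb hc m
  have hz : (X ^ d * c').coeff d = 0 := by rw [← hc', h, sub_self, coeff_zero]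
  have := coeff_X_pow_mul c' d 0
  rw [zero_add, hz, hc0'] at this
  exact nsmul_ne_zero_of_separating hB hm hc0 this.symm

/-- If additive maps to `ℤ` separate the points of `B`, then the exponents of the roots with
constant coefficient one of a fixed polynomial `p ≠ 1` are bounded. -/
theorem Polynomial.exists_exponent_bound
    (hB : ∀ x : B, x ≠ 0 → ∃ φ : B →+ ℤ, φ x ≠ 0) {p : B[X]} (hp : p ≠ 1) :
    ∃ N : ℕ, ∀ (a : B[X]) (m : ℕ), a.coeff 0 = 1 → a ^ m = p → m ≤ N := by
  obtain ⟨e, q, hq, hq0⟩ := exists_eq_X_pow_mul_of_ne_zero (sub_ne_zero.mpr hp)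
  obtain ⟨φ, hφ⟩ := hB _ hq0
  refine ⟨(φ (q.coeff 0)).natAbs, fun a m ha ham ↦ ?_⟩
  have hm : m ≠ 0 := by
    rintro rfl
    exact hp (by rw [← ham, pow_zero])
  have ha1 : a ≠ 1 := by
    rintro rfl
    exact hp (by rw [← ham, one_pow])
  obtain ⟨d, c, hc, hc0⟩ := exists_eq_X_pow_mul_of_ne_zero (sub_ne_zero.mpr ha1)
  obtain ⟨c', hc', hc0'⟩ := exists_pow_sub_pow_eq_X_pow_mul ha coeff_one_zero hc m
  have hne : c'.coeff 0 ≠ 0 := hc0' ▸ nsmul_ne_zero_of_separating hB hm hc0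
  rw [one_pow, ham, hq] at hc'
  rw [coeff_zero_eq_of_X_pow_mul_eq hq0 hne hc', hc0', map_nsmul] at hφ ⊢
  refine Nat.le_of_dvd (Int.natAbs_pos.mpr hφ) ?_
  simp [Int.natAbs_mul]

end PolynomialRoots

namespace RAAG

variable {V : Type u} (Γ : SimpleGraph V)

open scoped Pointwise

/-- The relations of the trace monoid: adjacent letters commute. -/
def traceRel (a b : FreeMonoid V) : Prop :=
  ∃ u v : V, Γ.Adj u v ∧ a = FreeMonoid.of u * FreeMonoid.of v ∧
    b = FreeMonoid.of v * FreeMonoid.of u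

/-- The trace monoid (positive partially commutative monoid) of a graph. -/
abbrev TraceMonoid : Type u := PresentedMonoid (traceRel Γ)

/-- The letter of the trace monoid corresponding to a vertex. -/
def letter (v : V) : TraceMonoid Γ := PresentedMonoid.of (traceRel Γ) v

variable {Γ}

theorem letter_mul_letter {u v : V} (h : Γ.Adj u v) :
    letter Γ u * letter Γ v = letter Γ v * letter Γ u :=
  PresentedMonoid.mk_eq_mk_of_rel ⟨u, v, h, rfl, rfl⟩

/-- A trace is repetition free if no word representing it has two equal consecutive
letters. -/
def RepetitionFree (t : TraceMonoid Γ) : Prop :=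
  ∀ (a : TraceMonoid Γ) (v : V) (b : TraceMonoid Γ), t ≠ a * letter Γ v * letter Γ v * b

theorem RepetitionFree.of_mul_right {s t : TraceMonoid Γ} (h : RepetitionFree (s * t)) :
    RepetitionFree s := by
  rintro a v b rfl
  exact h a v (b * t) (mul_assoc _ _ _)

theorem raagGen_mul_raagGen {u v : V} (h : Γ.Adj u v) :
    raagGen Γ u * raagGen Γ v = raagGen Γ v * raagGen Γ u := by
  have h1 := PresentedGroup.one_of_mem (rels := raagRels Γ) ⟨u, v, h, rfl⟩
  simp only [map_mul, map_inv] at h1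
  rwa [mul_inv_eq_one, mul_inv_eq_iff_eq_mul] at h1

variable (Γ) in
/-- The length of a trace. -/
def traceLength : TraceMonoid Γ →* Multiplicative ℕ :=
  PresentedMonoid.lift (fun _ ↦ Multiplicative.ofAdd 1) <| by
    rintro _ _ ⟨u, v, -, rfl, rfl⟩
    simp

theorem traceLength_letter (v : V) : traceLength Γ (letter Γ v) = Multiplicative.ofAdd 1 :=
  PresentedMonoid.lift_of ..

variable (Γ) in
/-- The set of group elements `v₁ ^ e₁ ⋯ vₖ ^ eₖ`, for a trace `v₁ ⋯ vₖ` and arbitrary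
integer exponents. -/
def spanSet : TraceMonoid Γ →* Set (RAAG Γ) :=
  PresentedMonoid.lift (fun v ↦ (Subgroup.zpowers (raagGen Γ v) : Set (RAAG Γ))) <| by
    have key : ∀ u v : V, Γ.Adj u v →
        (Subgroup.zpowers (raagGen Γ u) : Set (RAAG Γ)) * Subgroup.zpowers (raagGen Γ v) ⊆
          Subgroup.zpowers (raagGen Γ v) * Subgroup.zpowers (raagGen Γ u) := by
      rintro u v h _ ⟨_, ⟨i, rfl⟩, _, ⟨j, rfl⟩, rfl⟩
      refine ⟨_, ⟨j, rfl⟩, _, ⟨i, rfl⟩, ?_⟩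
      exact ((show Commute _ _ from raagGen_mul_raagGen h).zpow_zpow i j).symm
    rintro _ _ ⟨u, v, h, rfl, rfl⟩
    simpa using (key u v h).antisymm (key v u h.symm)

theorem spanSet_letter (v : V) :
    spanSet Γ (letter Γ v) = Subgroup.zpowers (raagGen Γ v) :=
  PresentedMonoid.lift_of ..

variable (Γ) in
/-- The group element `v₁ ^ e₁ ⋯ vₖ ^ eₖ` spelled by a list of syllables. -/
def syllableProd (L : List (V × ℤ)) : RAAG Γ := (L.map fun p ↦ raagGen Γ p.1 ^ p.2).prod

variable (Γ) in
/-- The trace `v₁ ⋯ vₖ` underlying a list of syllables. -/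
def syllableTrace (L : List (V × ℤ)) : TraceMonoid Γ := (L.map fun p ↦ letter Γ p.1).prod

theorem traceLength_syllableTrace (L : List (V × ℤ)) :
    traceLength Γ (syllableTrace Γ L) = Multiplicative.ofAdd L.length := by
  induction L with
  | nil => simp [syllableTrace]
  | cons p L ih =>
    simp only [syllableTrace, List.map_cons, List.prod_cons, map_mul, List.length_cons] at ih ⊢
    rw [ih, traceLength_letter, add_comm, ofAdd_add]

theorem syllableProd_mem_spanSet (L : List (V × ℤ)) :
    syllableProd Γ L ∈ spanSet Γ (syllableTrace Γ L) := by
  induction L with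
  | nil => simp [syllableTrace, syllableProd]
  | cons p L ih =>
    simp only [syllableTrace, syllableProd, List.map_cons, List.prod_cons, map_mul] at ih ⊢
    refine Set.mul_mem_mul ?_ ih
    rw [spanSet_letter]
    exact ⟨p.2, rfl⟩

theorem exists_syllables_of_mem_spanSet {t : TraceMonoid Γ} {g : RAAG Γ}
    (hg : g ∈ spanSet Γ t) : ∃ L, syllableProd Γ L = g ∧ syllableTrace Γ L = t := by
  obtain ⟨w, rfl⟩ := PresentedMonoid.surjective_mk t
  induction w using FreeMonoid.inductionOn' generalizing g with
  | one => exact ⟨[], by simpa [syllableProd, eq_comm] using hg, by simp [syllableTrace]⟩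
  | of_mul v w ih =>
    rw [map_mul, map_mul] at hg
    obtain ⟨x, hx, y, hy, rfl⟩ := hg
    obtain ⟨L, rfl, hL⟩ := ih hy
    obtain ⟨e, rfl⟩ : x ∈ (Subgroup.zpowers (raagGen Γ v) : Set (RAAG Γ)) := by
      rw [← spanSet_letter]
      exact hx
    refine ⟨(v, e) :: L, by simp [syllableProd], ?_⟩
    rw [map_mul, ← hL]
    simp [syllableTrace, letter, PresentedMonoid.of]

theorem exists_syllableProd_eq (g : RAAG Γ) : ∃ L, syllableProd Γ L = g := by
  have hclosed : g ∈ Subgroup.closure (Set.range (raagGen Γ)) := by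
    have := PresentedGroup.closure_range_of (raagRels Γ)
    change Subgroup.closure (Set.range (raagGen Γ)) = ⊤ at this
    rw [this]
    trivial
  induction hclosed using Subgroup.closure_induction_left with
  | one => exact ⟨[], rfl⟩
  | mul_left x hx y _ ih =>
    obtain ⟨v, rfl⟩ := hx
    obtain ⟨L, rfl⟩ := ih
    exact ⟨(v, 1) :: L, by simp [syllableProd]⟩
  | inv_mul_cancel x hx y _ ih =>
    obtain ⟨v, rfl⟩ := hx
    obtain ⟨L, rfl⟩ := ih
    exact ⟨(v, -1) :: L, by simp [syllableProd]⟩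

/-- Every element is spelled by a list of syllables with nonzero exponents and repetition-free
trace. -/
theorem exists_reduced_syllables (g : RAAG Γ) :
    ∃ L, syllableProd Γ L = g ∧ RepetitionFree (syllableTrace Γ L) ∧ ∀ p ∈ L, p.2 ≠ 0 := by
  obtain ⟨L, hL, hmin⟩ : ∃ L, syllableProd Γ L = g ∧
      ∀ L', syllableProd Γ L' = g → L.length ≤ L'.length := by
    have hne : {L | syllableProd Γ L = g}.Nonempty := exists_syllableProd_eq g
    exact ⟨Function.argminOn List.length _ hne, Function.argminOn_mem _ _ hne,
      fun L' hL' ↦ Function.argminOn_le _ {L | syllableProd Γ L = g} hL'⟩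
  refine ⟨L, hL, ?_, ?_⟩
  · intro a v b htrace
    have hmem := syllableProd_mem_spanSet (Γ := Γ) L
    have hlen := traceLength_syllableTrace (Γ := Γ) L
    rw [htrace] at hmem hlen
    have hspan : spanSet Γ (a * letter Γ v * letter Γ v * b) =
        spanSet Γ (a * letter Γ v * b) := by
      simp only [map_mul, spanSet_letter]
      rw [mul_assoc (spanSet Γ a), coe_mul_coe]
    rw [hspan, hL] at hmem
    obtain ⟨L', hL', htrace'⟩ := exists_syllables_of_mem_spanSet hmem
    have hlen' := traceLength_syllableTrace (Γ := Γ) L'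
    rw [htrace'] at hlen'
    have hle := hmin L' hL'
    apply_fun Multiplicative.toAdd at hlen hlen'
    simp only [map_mul, traceLength_letter, toAdd_mul, toAdd_ofAdd] at hlen hlen'
    lia
  · rintro p hp h0
    obtain ⟨L₁, L₂, rfl⟩ := List.append_of_mem hp
    have := hmin (L₁ ++ L₂) (by rw [← hL]; simp [syllableProd, h0])
    simp at this

variable (Γ) in
/-- The coefficient ring of the Magnus representation. -/
abbrev MagnusCoeff : Type u := Module.End ℤ (TraceMonoid Γ → ℤ)

open Classical in
variable (Γ) in
/-- The operator on functions on the trace monoid translating by a trace, truncated to vanish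
at places where a repetition arises. -/
noncomputable def shift (t : TraceMonoid Γ) : MagnusCoeff Γ where
  toFun f m := if RepetitionFree (m * t) then f (m * t) else 0
  map_add' f g := by
    ext m
    by_cases h : RepetitionFree (m * t) <;> simp [h]
  map_smul' c f := by
    ext m
    by_cases h : RepetitionFree (m * t) <;> simp [h]

open Classical in
theorem shift_apply (t : TraceMonoid Γ) (f : TraceMonoid Γ → ℤ) (m : TraceMonoid Γ) :
    shift Γ t f m = if RepetitionFree (m * t) then f (m * t) else 0 := rfl

theorem shift_mul (s t : TraceMonoid Γ) : shift Γ s * shift Γ t = shift Γ (s * t) := by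
  refine LinearMap.ext fun f ↦ funext fun m ↦ ?_
  rw [Module.End.mul_apply, shift_apply, shift_apply, shift_apply, ← mul_assoc]
  by_cases h : RepetitionFree (m * s * t)
  · rw [if_pos h, if_pos h.of_mul_right]
  · rw [if_neg h, ite_self]

theorem shift_letter_mul_self (v : V) : shift Γ (letter Γ v) * shift Γ (letter Γ v) = 0 := by
  refine LinearMap.ext fun f ↦ funext fun m ↦ ?_
  rw [shift_mul, shift_apply, if_neg]
  · rfl
  · exact fun h ↦ h m v 1 (by simp [mul_assoc])

/-- Evaluating the product of the scaled shifts along a repetition-free list of syllables on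
the constant function `1` gives the product of the exponents. -/
theorem prod_smul_shift_apply (L : List (V × ℤ)) (m : TraceMonoid Γ)
    (h : RepetitionFree (m * syllableTrace Γ L)) :
    (L.map fun p ↦ p.2 • shift Γ (letter Γ p.1)).prod (fun _ ↦ 1) m =
      (L.map Prod.snd).prod := by
  induction L generalizing m with
  | nil => simp
  | cons p L ih =>
    have h' : RepetitionFree (m * letter Γ p.1 * syllableTrace Γ L) := by
      simpa [syllableTrace, mul_assoc] using h
    simp only [List.map_cons, List.prod_cons, Module.End.mul_apply, LinearMap.smul_apply,
      Pi.smul_apply, shift_apply, if_pos h'.of_mul_right, ih _ h', smul_eq_mul]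

open Polynomial

theorem one_add_shift_mul_one_add_shift (v : V) (i j : ℤ) :
    (1 + C (i • shift Γ (letter Γ v)) * X) * (1 + C (j • shift Γ (letter Γ v)) * X) =
      1 + C ((i + j) • shift Γ (letter Γ v)) * X := by
  have hz : C (i • shift Γ (letter Γ v)) * X * (C (j • shift Γ (letter Γ v)) * X) = 0 := by
    rw [mul_assoc, ← mul_assoc X, X_mul, mul_assoc, ← mul_assoc, ← C_mul, smul_mul_smul_comm,
      shift_letter_mul_self, smul_zero, C_0, zero_mul]
  rw [mul_add, add_mul, add_mul, hz, add_smul, C_add, add_mul]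
  simp [add_assoc]

variable (Γ) in
/-- The unit `1 + e v X` of the polynomial ring, the image of `v ^ e` under the Magnus
representation. -/
noncomputable def magnusUnit (v : V) : Multiplicative ℤ →* (MagnusCoeff Γ)[X]ˣ :=
  MonoidHom.toHomUnits
    { toFun e := 1 + C (e.toAdd • shift Γ (letter Γ v)) * X
      map_one' := by simp
      map_mul' i j := (one_add_shift_mul_one_add_shift v i.toAdd j.toAdd).symm }

theorem coe_magnusUnit (v : V) (e : Multiplicative ℤ) :
    (magnusUnit Γ v e : (MagnusCoeff Γ)[X]) = 1 + C (e.toAdd • shift Γ (letter Γ v)) * X := rfl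

variable (Γ) in
/-- The Magnus representation of a right-angled Artin group. -/
noncomputable def magnus : RAAG Γ →* (MagnusCoeff Γ)[X]ˣ :=
  PresentedGroup.toGroup (f := fun v ↦ magnusUnit Γ v (Multiplicative.ofAdd 1)) <| by
    rintro _ ⟨u, v, h, rfl⟩
    simp only [map_mul, map_inv, FreeGroup.lift_apply_of]
    rw [mul_inv_eq_one, mul_inv_eq_iff_eq_mul]
    ext1
    have hc : (C (shift Γ (letter Γ u)) : (MagnusCoeff Γ)[X]) * X *
        (C (shift Γ (letter Γ v)) * X) =
          C (shift Γ (letter Γ v)) * X * (C (shift Γ (letter Γ u)) * X) := by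
      simp only [mul_assoc, X_mul]
      simp only [← mul_assoc, ← C_mul, shift_mul, letter_mul_letter h]
    simp only [Units.val_mul, coe_magnusUnit, toAdd_ofAdd, one_smul, mul_add, add_mul, hc]
    simp only [one_mul, mul_one]
    abel

theorem magnus_raagGen_zpow (v : V) (e : ℤ) :
    (magnus Γ (raagGen Γ v ^ e) : (MagnusCoeff Γ)[X]) =
      1 + C (e • shift Γ (letter Γ v)) * X := by
  have h : magnus Γ (raagGen Γ v) = magnusUnit Γ v (Multiplicative.ofAdd 1) :=
    PresentedGroup.toGroup.of _
  rw [map_zpow, h, ← map_zpow, coe_magnusUnit]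
  simp

theorem magnus_syllableProd (L : List (V × ℤ)) :
    (magnus Γ (syllableProd Γ L) : (MagnusCoeff Γ)[X]) =
      (L.map fun p ↦ 1 + C (p.2 • shift Γ (letter Γ p.1)) * X).prod := by
  induction L with
  | nil => simp [syllableProd]
  | cons p L ih =>
    simp only [syllableProd, List.map_cons, List.prod_cons, map_mul, Units.val_mul,
      magnus_raagGen_zpow] at ih ⊢
    rw [ih]

theorem coeff_zero_magnus (g : RAAG Γ) : (magnus Γ g : (MagnusCoeff Γ)[X]).coeff 0 = 1 := by
  obtain ⟨L, rfl⟩ := exists_syllableProd_eq g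
  rw [magnus_syllableProd, ← constantCoeff_apply, map_list_prod, List.map_map]
  refine List.prod_eq_one fun x hx ↦ ?_
  obtain ⟨p, -, rfl⟩ := List.mem_map.mp hx
  simp

theorem magnus_injective : Function.Injective (magnus Γ) := by
  refine (injective_iff_map_eq_one _).mpr fun g hg ↦ ?_
  obtain ⟨L, rfl, hfree, hexp⟩ := exists_reduced_syllables g
  by_contra hne
  have hlen : L.length ≠ 0 := by
    intro h0
    rw [List.length_eq_zero_iff] at h0
    exact hne (by simp [h0, syllableProd])
  have hcoeff := coeff_list_prod_of_natDegree_le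
    (L.map fun p ↦ 1 + C (p.2 • shift Γ (letter Γ p.1)) * X) 1 <| by
      simp only [List.mem_map, forall_exists_index, and_imp]
      rintro _ p - rfl
      compute_degree
  rw [← magnus_syllableProd, hg, List.length_map, mul_one, Units.val_one, coeff_one,
    if_neg hlen, List.map_map] at hcoeff
  have hprod := prod_smul_shift_apply (Γ := Γ) L 1 (by rwa [one_mul])
  have hfun : ((fun p : (MagnusCoeff Γ)[X] ↦ p.coeff 1) ∘
      fun p : V × ℤ ↦ 1 + C (p.2 • shift Γ (letter Γ p.1)) * X) =
        fun p ↦ p.2 • shift Γ (letter Γ p.1) := by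
    funext p
    simp [coeff_one]
  rw [hfun] at hcoeff
  rw [← hcoeff] at hprod
  refine List.prod_ne_zero (l := L.map Prod.snd) ?_ hprod.symm
  simpa using fun v hv ↦ hexp (v, 0) hv rfl

theorem exists_addMonoidHom_ne_zero {x : MagnusCoeff Γ} (hx : x ≠ 0) :
    ∃ φ : MagnusCoeff Γ →+ ℤ, φ x ≠ 0 := by
  obtain ⟨f, hf⟩ : ∃ f, x f ≠ 0 := by
    by_contra! h
    exact hx (LinearMap.ext h)
  obtain ⟨m, hm⟩ := Function.ne_iff.mp hf
  exact ⟨(Pi.evalAddMonoidHom (fun _ ↦ ℤ) m).comp (LinearMap.applyₗ' ℤ f).toAddMonoidHom, hm⟩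

end RAAG

/-- Every non-trivial element of `A(Γ)` belongs to a unique maximal infinite cyclic
subgroup. -/
theorem unique_maximal_cyclic {V : Type u} (Γ : SimpleGraph V) (g : RAAG Γ)
    (hg : g ≠ 1) :
    ∃! H : Subgroup (RAAG Γ), g ∈ H ∧ IsMaxInfCyclic H := by
  refine existsUnique_isMaxInfCyclic (fun a b n hn h ↦ ?_) hg ?_
  · refine RAAG.magnus_injective (Units.ext ?_)
    refine Polynomial.eq_of_pow_eq_pow_of_coeff_zero_eq_one
      (fun _ ↦ RAAG.exists_addMonoidHom_ne_zero) (RAAG.coeff_zero_magnus a)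
      (RAAG.coeff_zero_magnus b) hn ?_
    rw [← Units.val_pow_eq_pow_val, ← Units.val_pow_eq_pow_val, ← map_pow, ← map_pow, h]
  · have hne : (RAAG.magnus Γ g : Polynomial (RAAG.MagnusCoeff Γ)) ≠ 1 := fun h1 ↦
      hg (RAAG.magnus_injective (by rw [map_one]; exact Units.ext h1))
    obtain ⟨N, hN⟩ := Polynomial.exists_exponent_bound
      (fun _ ↦ RAAG.exists_addMonoidHom_ne_zero) hne
    refine ⟨N, fun a n h ↦ hN _ n (RAAG.coeff_zero_magnus a) ?_⟩
    rw [← Units.val_pow_eq_pow_val, ← map_pow, h]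
end
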